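/- arXiv:2009.12300 — 11 statements merged into one kernel-verified Lean document; each statement's English description precedes it below -/
import Mathlib

section
/- Let K > 0 be a real number and let n be a natural number. Then the set of monic polynomials of degree n with integer coefficients, all of whose complex roots are real and lie in the interval [−K, K], is finite. -/
/-- There are only finitely many monic integer polynomials of degree `n` all of
whose complex roots are real and lie in `[-K, K]`. -/
theorem finite_monic_int_polys_with_bounded_real_roots (K : ℝ) (hK : 0 < K) (n : ℕ) :
    {p : Polynomial ℤ | p.Monic ∧ p.natDegree = n ∧
      ∀ z : ℂ, Polynomial.aeval z p = 0 →
        z.im = 0 ∧ -K ≤ z.re ∧ z.re ≤ K}.Finite := by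
  set C : ℝ := max K 1 ^ n * n.choose (n / 2) with hC
  have hfin : (Set.Icc (fun _ : Fin (n + 1) => -⌈C⌉) (fun _ => ⌈C⌉)).Finite :=
    Set.finite_Icc _ _
  refine Set.Finite.of_finite_image (f := fun p : Polynomial ℤ =>
    fun i : Fin (n + 1) => p.coeff i) (hfin.subset ?_) ?_
  · rintro _ ⟨p, ⟨hm, hd, hr⟩, rfl⟩
    have key : ∀ i : ℕ, |p.coeff i| ≤ ⌈C⌉ := by
      intro i
      have h := Polynomial.coeff_bdd_of_roots_le (B := K) (d := n) (Int.castRingHom ℂ) hm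
        (IsAlgClosed.splits _) hd.le (fun z hz => by
          have hz0 : Polynomial.aeval z p = 0 := by
            have h1 := (Polynomial.mem_roots'.1 hz).2
            rw [Polynomial.IsRoot.def, Polynomial.eval_map] at h1
            exact h1
          obtain ⟨h1, h2, h3⟩ := hr z hz0
          rw [← Complex.abs_re_eq_norm.2 h1]
          exact abs_le.2 ⟨h2, h3⟩) i
      rw [Polynomial.coeff_map, eq_intCast, Complex.norm_intCast] at h
      have h2 := h.trans (Int.le_ceil C)
      exact_mod_cast h2
    exact ⟨fun i => (abs_le.1 (key i)).1, fun i => (abs_le.1 (key i)).2⟩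
  · rintro p ⟨_, hp, _⟩ q ⟨_, hq, _⟩ h
    ext i
    by_cases hi : i < n + 1
    · exact congrFun h ⟨i, hi⟩
    · rw [Polynomial.coeff_eq_zero_of_natDegree_lt (by omega),
        Polynomial.coeff_eq_zero_of_natDegree_lt (by omega)]
end

section
/- If a connected simple graph G is locally the Rook graph K3 □ K2 (the Cartesian product of the complete graphs K3 and K2), then G is isomorphic to the Johnson graph J(5,2). -/
open SimpleGraph

/-- The Rook graph `K3 □ K2`. -/
def rookGraph : SimpleGraph (Fin 3 × Fin 2) :=
  (⊤ : SimpleGraph (Fin 3)) □ (⊤ : SimpleGraph (Fin 2))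

/-- The Johnson graph `J(5,2)`: vertices are the 2-element subsets of a 5-element
set, adjacent iff they intersect nontrivially. -/
def johnsonGraph52 : SimpleGraph {s : Finset (Fin 5) // s.card = 2} :=
  SimpleGraph.fromRel fun a b => (a.1 ∩ b.1).Nonempty

namespace LocRook

/-- Adjacency pattern of the prism on `a0 a1 a2 b0 b1 b2`. -/
structure Prism {V : Type*} (R : V → V → Prop) (a0 a1 a2 b0 b1 b2 : V) : Prop where
  a01 : R a0 a1
  a02 : R a0 a2
  a12 : R a1 a2
  b01 : R b0 b1
  b02 : R b0 b2
  b12 : R b1 b2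
  m0 : R a0 b0
  m1 : R a1 b1
  m2 : R a2 b2
  n01 : ¬ R a0 b1
  n02 : ¬ R a0 b2
  n10 : ¬ R a1 b0
  n12 : ¬ R a1 b2
  n20 : ¬ R a2 b0
  n21 : ¬ R a2 b1
  e01 : a0 ≠ b1
  e02 : a0 ≠ b2
  e10 : a1 ≠ b0
  e12 : a1 ≠ b2
  e20 : a2 ≠ b0
  e21 : a2 ≠ b1

/-- The neighbourhood of `v` is the prism on the given vertices. -/
structure Loc {V : Type*} (G : SimpleGraph V) (v a0 a1 a2 b0 b1 b2 : V) : Prop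
    extends Prism G.Adj a0 a1 a2 b0 b1 b2 where
  va0 : G.Adj v a0
  va1 : G.Adj v a1
  va2 : G.Adj v a2
  vb0 : G.Adj v b0
  vb1 : G.Adj v b1
  vb2 : G.Adj v b2
  full : ∀ w, G.Adj v w → w = a0 ∨ w = a1 ∨ w = a2 ∨ w = b0 ∨ w = b1 ∨ w = b2

/-- Explicit rook adjacency. -/
abbrev R (p q : Fin 3 × Fin 2) : Prop := (p.1 ≠ q.1 ∧ p.2 = q.2) ∨ (p.2 ≠ q.2 ∧ p.1 = q.1)

theorem rook_adj (p q : Fin 3 × Fin 2) : rookGraph.Adj p q ↔ R p q := by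
  simp [rookGraph, boxProd_adj, R]

theorem R_ext : ∀ p q r s : Fin 3 × Fin 2, R p q → R p r → R q r → R p s → ¬ R q s → ¬ R r s →
    q ≠ s → r ≠ s → ∃ x y, R s x ∧ R s y ∧ R x y ∧ R q x ∧ R r y ∧ ¬ R p x ∧ ¬ R p y ∧
      ¬ R q y ∧ ¬ R r x ∧ p ≠ x ∧ p ≠ y ∧ q ≠ y ∧ r ≠ x ∧
      ∀ w, w = p ∨ w = q ∨ w = r ∨ w = s ∨ w = x ∨ w = y := by
  set_option synthInstance.maxHeartbeats 400000 in
  set_option synthInstance.maxSize 4000 in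
  set_option maxRecDepth 100000 in
  decide

variable {V : Type*} {G : SimpleGraph V}

/-- Coordinates on a neighbourhood. -/
theorem coords {v : V} (h : Nonempty ((G.induce (G.neighborSet v)) ≃g rookGraph)) :
    ∃ n : Fin 3 × Fin 2 → V, Function.Injective n ∧ (∀ p q, G.Adj (n p) (n q) ↔ R p q) ∧
      (∀ p, G.Adj v (n p)) ∧ ∀ w, G.Adj v w → ∃ p, n p = w := by
  obtain ⟨e⟩ := h
  refine ⟨fun p => (e.symm p).1, ?_, ?_, ?_, ?_⟩
  · exact Subtype.val_injective.comp e.symm.injective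
  · intro p q
    rw [← rook_adj, ← e.symm.map_adj_iff]
    rfl
  · intro p
    exact (e.symm p).2
  · intro w hw
    exact ⟨e ⟨w, hw⟩, by simp⟩

theorem loc_ext {v a0 a1 a2 b0 : V}
    (h : Nonempty ((G.induce (G.neighborSet v)) ≃g rookGraph))
    (va0 : G.Adj v a0) (va1 : G.Adj v a1) (va2 : G.Adj v a2) (vb0 : G.Adj v b0)
    (a01 : G.Adj a0 a1) (a02 : G.Adj a0 a2) (a12 : G.Adj a1 a2) (m0 : G.Adj a0 b0)
    (n10 : ¬ G.Adj a1 b0) (n20 : ¬ G.Adj a2 b0) (e10 : a1 ≠ b0) (e20 : a2 ≠ b0) :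
    ∃ x y, Loc G v a0 a1 a2 b0 x y := by
  obtain ⟨n, hi, ha, hv, hs⟩ := coords h
  obtain ⟨p, rfl⟩ := hs _ va0
  obtain ⟨q, rfl⟩ := hs _ va1
  obtain ⟨r, rfl⟩ := hs _ va2
  obtain ⟨s, rfl⟩ := hs _ vb0
  simp only [ha] at a01 a02 a12 m0 n10 n20
  obtain ⟨x, y, h1, h2, h3, h4, h5, h6, h7, h8, h9, h10, h11, h12, h13, h14⟩ :=
    R_ext p q r s a01 a02 a12 m0 n10 n20 (fun h => e10 (h ▸ rfl)) (fun h => e20 (h ▸ rfl))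
  refine ⟨n x, n y, ⟨⟨?_, ?_, ?_, ?_, ?_, ?_, ?_, ?_, ?_, ?_, ?_, ?_, ?_, ?_, ?_, ?_, ?_, ?_, ?_,
    ?_, ?_⟩, va0, va1, va2, vb0, hv x, hv y, ?_⟩⟩
  on_goal 22 =>
    intro w hw
    obtain ⟨w, rfl⟩ := hs _ hw
    simpa only [hi.eq_iff] using h14 w
  all_goals first | (rw [ha]; assumption) | assumption | (rw [hi.ne_iff]; assumption)

theorem loc_start {v : V} (h : Nonempty ((G.induce (G.neighborSet v)) ≃g rookGraph)) :
    ∃ a0 a1 a2 b0 b1 b2, Loc G v a0 a1 a2 b0 b1 b2 := by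
  obtain ⟨n, hi, ha, hv, hs⟩ := coords h
  refine ⟨n (0,0), n (1,0), n (2,0), n (0,1), loc_ext h (hv _) (hv _) (hv _) (hv _) ?_ ?_ ?_ ?_
    ?_ ?_ ?_ ?_⟩
  all_goals first | (rw [ha]; decide) | (rw [hi.ne_iff]; decide)

theorem deg_six {v : V} (h : Nonempty ((G.induce (G.neighborSet v)) ≃g rookGraph)) :
    (G.neighborSet v).ncard = 6 := by
  obtain ⟨e⟩ := h
  rw [← Nat.card_coe_set_eq, Nat.card_congr e.toEquiv]
  simp

/-- An injective homomorphism from a finite 6-regular graph is an isomorphism. -/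
theorem iso_of_hom {W : Type*} [Finite W] [Nonempty W] {H : SimpleGraph W} (hconn : G.Connected)
    (hG : ∀ v, (G.neighborSet v).ncard = 6) (hH : ∀ w, (H.neighborSet w).ncard = 6)
    (f : W → V) (hf : Function.Injective f) (hom : ∀ a b, H.Adj a b → G.Adj (f a) (f b)) :
    Nonempty (H ≃g G) := by
  have key : ∀ w, Set.image f (H.neighborSet w) = G.neighborSet (f w) := by
    intro w
    apply Set.eq_of_subset_of_ncard_le
    · rintro _ ⟨b, hb, rfl⟩
      exact hom _ _ hb
    · rw [hG, Set.ncard_image_of_injective _ hf, hH]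
    · exact Set.finite_of_ncard_ne_zero (by rw [hG]; decide)
  have surj : Function.Surjective f := by
    intro u
    obtain ⟨w0⟩ := ‹Nonempty W›
    obtain ⟨p⟩ := hconn.preconnected u (f w0)
    have : ∀ (a b : V) (_ : G.Walk a b), (∃ w, f w = b) → ∃ w, f w = a := by
      intro a b p
      induction p with
      | nil => exact id
      | cons hadj p ih =>
        intro hb
        obtain ⟨w, rfl⟩ := ih hb
        have : _ ∈ G.neighborSet (f w) := hadj.symm
        rw [← key] at this
        obtain ⟨c, -, hc⟩ := this
        exact ⟨c, hc⟩
    exact this _ _ p ⟨w0, rfl⟩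
  refine ⟨⟨Equiv.ofBijective f ⟨hf, surj⟩, ?_⟩⟩
  intro a b
  change G.Adj (f a) (f b) ↔ H.Adj a b
  refine ⟨fun h => ?_, hom a b⟩
  have : f b ∈ G.neighborSet (f a) := h
  rw [← key] at this
  obtain ⟨c, hc, hcb⟩ := this
  exact hf hcb ▸ hc

/-- Ends of the pairs. -/
def lo : Fin 10 → Fin 5 := ![0, 0, 0, 0, 1, 1, 1, 2, 2, 3]
/-- Ends of the pairs. -/
def hi : Fin 10 → Fin 5 := ![1, 2, 3, 4, 2, 3, 4, 3, 4, 4]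

theorem lo_ne_hi : ∀ i, lo i ≠ hi i := by decide

/-- Enumeration of the Johnson vertices. -/
def E (i : Fin 10) : {s : Finset (Fin 5) // s.card = 2} :=
  ⟨{lo i, hi i}, Finset.card_pair (lo_ne_hi i)⟩

theorem E_inj : Function.Injective E := by
  have : ∀ i j, E i = E j → i = j := by decide
  exact this

theorem E_bij : Function.Bijective E := by
  rw [Fintype.bijective_iff_injective_and_card]
  refine ⟨E_inj, ?_⟩
  rw [Fintype.card_finset_len]
  decide

/-- Explicit adjacency on `Fin 10`. -/
abbrev S (i j : Fin 10) : Prop :=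
  i ≠ j ∧ (lo i = lo j ∨ lo i = hi j ∨ hi i = lo j ∨ hi i = hi j)

theorem E_adj : ∀ i j, johnsonGraph52.Adj (E i) (E j) ↔ S i j := by
  have h : ∀ i j, (E i ≠ E j ∧ ((E i).1 ∩ (E j).1 ≠ ∅ ∨ (E j).1 ∩ (E i).1 ≠ ∅)) ↔ S i j := by
    decide
  intro i j
  rw [← h]
  simp only [johnsonGraph52, SimpleGraph.fromRel_adj, Finset.nonempty_iff_ne_empty]

/-- The graph on `Fin 10`. -/
def T : SimpleGraph (Fin 10) := johnsonGraph52.comap E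

theorem T_deg (i : Fin 10) : (T.neighborSet i).ncard = 6 := by
  have : T.neighborSet i = ((Finset.univ.filter (fun j => S i j) : Finset (Fin 10)) : Set _) := by
    ext j
    simp only [T, SimpleGraph.mem_neighborSet, SimpleGraph.comap_adj, E_adj, Finset.coe_filter,
      Finset.mem_univ, true_and, Set.mem_ofPred_eq]
  rw [this, Set.ncard_coe_finset]
  clear this
  revert i
  decide

theorem exists_hom (hloc : ∀ v : V, Nonempty ((G.induce (G.neighborSet v)) ≃g rookGraph))
    (v : V) : ∃ f : Fin 10 → V, Function.Injective f ∧ ∀ i j, S i j → G.Adj (f i) (f j) := by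
  obtain ⟨a0, a1, a2, b0, b1, b2, L⟩ := loc_start (hloc v)
  obtain ⟨x, y, L0⟩ := loc_ext (hloc a0) L.va0.symm L.a01 L.a02 L.m0 L.va1 L.va2 L.a12 L.vb0
    L.n10 L.n20 L.e10 L.e20
  obtain ⟨xx, z, L1⟩ := loc_ext (hloc a1) L.va1.symm L.a01.symm L.a12 L.m1 L.va0 L.va2 L.a02 L.vb1
    L.n01 L.n21 L.e01 L.e21
  obtain ⟨yy, zz, L2⟩ := loc_ext (hloc a2) L.va2.symm L.a02.symm L.a12.symm L.m2 L.va0 L.va1 L.a01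
    L.vb2 L.n02 L.n12 L.e02 L.e12
  have hx : x = xx := by
    have h1 := L1.full x L0.m1
    have h2 := L0.m1
    grind [L0.n01, L0.e01, L0.n21, L0.e21, L1.n10, L1.n12, L0.vb1, G.loopless, SimpleGraph.irrefl]
  have hy : y = yy := by
    have h1 := L2.full y L0.m2
    have h2 := L0.m2
    grind [L0.n02, L0.e02, L0.n12, L0.e12, L2.n10, L2.n12, L0.vb2, SimpleGraph.irrefl]
  have hz : z = zz := by
    have h1 := L2.full z L1.m2
    have h2 := L1.m2
    have h3 : ¬ G.Adj a1 b2 := L.n12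
    grind [L1.n02, L1.e02, L1.n12, L1.e12, L2.n20, L2.n21, L1.vb2, SimpleGraph.irrefl]
  subst hx hy hz
  have hvx : ¬ G.Adj v x := L0.n01
  have hvy : ¬ G.Adj v y := L0.n02
  have hvz : ¬ G.Adj v z := L1.n02
  have far : ∀ {c w : V}, ¬ G.Adj v c → G.Adj v w → w ≠ c := by
    rintro c w h1 h2 rfl
    exact h1 h2
  refine ⟨![v, a0, a1, a2, b0, b1, b2, x, y, z], ?_, ?_⟩
  · have key : ∀ i j : Fin 10, i < j →
        (![v, a0, a1, a2, b0, b1, b2, x, y, z] : Fin 10 → V) i ≠ ![v, a0, a1, a2, b0, b1, b2, x, y, z] j := by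
      have hva := L.va0.ne
      have := L.va1.ne
      have := L.va2.ne
      have := L.vb0.ne
      have := L.vb1.ne
      have := L.vb2.ne
      have := L0.e01
      have := L0.e02
      have := L1.e02
      have := L.a01.ne
      have := L.a02.ne
      have := L.a12.ne
      have := L.b01.ne
      have := L.b02.ne
      have := L.b12.ne
      have := L.m0.ne
      have := L.m1.ne
      have := L.m2.ne
      have := L.e01
      have := L.e02
      have := L.e10
      have := L.e12
      have := L.e20
      have := L.e21
      have := L0.b12.ne
      have := L1.b12.ne
      have := L2.b12.ne
      have l0 := L.va0
      have l1 := L.va1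
      have l2 := L.va2
      have l3 := L.vb0
      have l4 := L.vb1
      have l5 := L.vb2
      intro i j hij
      fin_cases i <;> fin_cases j <;>
        first
          | exact absurd hij (by decide)
          | assumption
          | exact far hvx (by assumption)
          | exact far hvy (by assumption)
          | exact far hvz (by assumption)
    intro i j h
    rcases lt_trichotomy i j with h1 | h1 | h1
    · exact absurd h (key i j h1)
    · exact h1
    · exact absurd h.symm (key j i h1)
  · have key : ∀ i j : Fin 10, i < j → S i j →
        G.Adj ((![v, a0, a1, a2, b0, b1, b2, x, y, z] : Fin 10 → V) i)
          (![v, a0, a1, a2, b0, b1, b2, x, y, z] j) := by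
      intro i j hij hS
      obtain ⟨⟨⟩⟩ := L
      obtain ⟨⟨⟩⟩ := L0
      obtain ⟨⟨⟩⟩ := L1
      obtain ⟨⟨⟩⟩ := L2
      fin_cases i <;> fin_cases j <;>
        first
          | exact absurd hij (by decide)
          | exact absurd hS (by decide)
          | assumption
    intro i j h
    rcases lt_trichotomy i j with h1 | h1 | h1
    · exact key i j h1 h
    · exact absurd h1 h.1
    · exact (key j i h1 ⟨h.1.symm, by grind [h.2]⟩).symm

end LocRook

/-- A connected graph that is locally the Rook graph `K3 □ K2` is isomorphic to
the Johnson graph `J(5,2)`. -/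
theorem locally_rook_iso_johnson {V : Type*} (G : SimpleGraph V)
    (hconn : G.Connected)
    (hloc : ∀ v : V, Nonempty ((G.induce (G.neighborSet v)) ≃g rookGraph)) :
    Nonempty (G ≃g johnsonGraph52) := by
  obtain ⟨v⟩ := hconn.nonempty
  obtain ⟨f, hf, hom⟩ := LocRook.exists_hom hloc v
  obtain ⟨e⟩ := LocRook.iso_of_hom (H := LocRook.T) hconn (fun v => LocRook.deg_six (hloc v))
    LocRook.T_deg f hf (fun a b h => hom a b ((LocRook.E_adj a b).1 h))
  have e2 : LocRook.T ≃g johnsonGraph52 :=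
    ⟨Equiv.ofBijective LocRook.E LocRook.E_bij, Iff.rfl⟩
  exact ⟨e.symm.trans e2⟩
end

section
/- Every connected simple graph G that is locally the Rook graph K3 □ K2 has exactly 10 vertices. -/
open SimpleGraph

/-- `v` has neighbourhood the prism with triangles `p q r`, `x y z`. -/
structure PrismAt {V : Type*} (G : SimpleGraph V) (v p q r x y z : V) : Prop where
  vx : G.Adj v x
  vy : G.Adj v y
  vz : G.Adj v z
  xy : G.Adj x y
  xz : G.Adj x z
  yz : G.Adj y z
  px : G.Adj p x
  qy : G.Adj q y
  rz : G.Adj r z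
  npy : ¬ G.Adj p y
  npz : ¬ G.Adj p z
  nqx : ¬ G.Adj q x
  nqz : ¬ G.Adj q z
  nrx : ¬ G.Adj r x
  nry : ¬ G.Adj r y
  cover : ∀ w, G.Adj v w → w = p ∨ w = q ∨ w = r ∨ w = x ∨ w = y ∨ w = z

instance : DecidableRel rookGraph.Adj := fun a b =>
  decidable_of_iff (a.1 ≠ b.1 ∧ a.2 = b.2 ∨ a.2 ≠ b.2 ∧ a.1 = b.1) (by
    simp [rookGraph, SimpleGraph.boxProd_adj])

theorem prism_rook : ∀ p q r : Fin 3 × Fin 2, rookGraph.Adj p q → rookGraph.Adj p r →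
    rookGraph.Adj q r → 
    ((rookGraph.Adj (p.1, p.2+1) (q.1, q.2+1) ∧ rookGraph.Adj (p.1, p.2+1) (r.1, r.2+1) ∧
      rookGraph.Adj (q.1, q.2+1) (r.1, r.2+1)) ∧
     (rookGraph.Adj p (p.1, p.2+1) ∧ rookGraph.Adj q (q.1, q.2+1) ∧
      rookGraph.Adj r (r.1, r.2+1)) ∧
     (¬ rookGraph.Adj p (q.1, q.2+1) ∧ ¬ rookGraph.Adj p (r.1, r.2+1) ∧
      ¬ rookGraph.Adj q (p.1, p.2+1) ∧ ¬ rookGraph.Adj q (r.1, r.2+1) ∧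
      ¬ rookGraph.Adj r (p.1, p.2+1) ∧ ¬ rookGraph.Adj r (q.1, q.2+1)) ∧
     ∀ w, w = p ∨ w = q ∨ w = r ∨ w = (p.1, p.2+1) ∨ w = (q.1, q.2+1) ∨ w = (r.1, r.2+1)) := by
  decide

theorem exists_prism {V : Type*} (G : SimpleGraph V)
    (hloc : ∀ v : V, Nonempty ((G.induce (G.neighborSet v)) ≃g rookGraph))
    (v p q r : V) (hp : G.Adj v p) (hq : G.Adj v q) (hr : G.Adj v r)
    (hpq : G.Adj p q) (hpr : G.Adj p r) (hqr : G.Adj q r) :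
    ∃ x y z, PrismAt G v p q r x y z := by
  obtain ⟨f⟩ := hloc v
  have key : ∀ s t : Fin 3 × Fin 2, rookGraph.Adj s t ↔ G.Adj (f.symm s) (f.symm t) := by
    intro s t
    rw [← f.symm.map_adj_iff]; rfl
  obtain ⟨p', rfl⟩ : ∃ s, p = f.symm s := ⟨f ⟨p, hp⟩, by simp⟩
  obtain ⟨q', rfl⟩ : ∃ s, q = f.symm s := ⟨f ⟨q, hq⟩, by simp⟩
  obtain ⟨r', rfl⟩ : ∃ s, r = f.symm s := ⟨f ⟨r, hr⟩, by simp⟩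
  rw [← key] at hpq hpr hqr
  rcases prism_rook p' q' r' hpq hpr hqr with ⟨⟨h1, h2, h3⟩, ⟨h4, h5, h6⟩,
    ⟨h7, h8, h9, h10, h11, h12⟩, hc⟩
  · simp only [key] at h1 h2 h3 h4 h5 h6 h7 h8 h9 h10 h11 h12
    refine ⟨_, _, _, (f.symm _).2, (f.symm _).2, (f.symm _).2, h1, h2, h3, h4, h5, h6,
      h7, h8, h9, h10, h11, h12, ?_⟩
    intro w hw
    obtain ⟨w', rfl⟩ : ∃ s, w = f.symm s := ⟨f ⟨w, hw⟩, by simp⟩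
    rcases hc w' with h | h | h | h | h | h <;> simp [← h]

theorem exists_base {V : Type*} (G : SimpleGraph V)
    (hloc : ∀ v : V, Nonempty ((G.induce (G.neighborSet v)) ≃g rookGraph)) (v : V) :
    ∃ p q r, G.Adj v p ∧ G.Adj v q ∧ G.Adj v r ∧ G.Adj p q ∧ G.Adj p r ∧ G.Adj q r := by
  obtain ⟨f⟩ := hloc v
  have key : ∀ s t : Fin 3 × Fin 2, rookGraph.Adj s t → G.Adj (f.symm s) (f.symm t) := by
    intro s t h
    rw [← f.symm.map_adj_iff] at h; exact h
  exact ⟨f.symm (0,0), f.symm (1,0), f.symm (2,0), (f.symm _).2, (f.symm _).2, (f.symm _).2,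
    key _ _ (by decide), key _ _ (by decide), key _ _ (by decide)⟩

theorem PrismAt.swap12 {V : Type*} {G : SimpleGraph V} {v p q r x y z : V}
    (h : PrismAt G v p q r x y z) : PrismAt G v q p r y x z :=
  ⟨h.vy, h.vx, h.vz, h.xy.symm, h.yz, h.xz, h.qy, h.px, h.rz, h.nqx, h.nqz, h.npy, h.npz,
    h.nry, h.nrx, fun w hw => by have := h.cover w hw; tauto⟩

theorem PrismAt.swap23 {V : Type*} {G : SimpleGraph V} {v p q r x y z : V}
    (h : PrismAt G v p q r x y z) : PrismAt G v p r q x z y :=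
  ⟨h.vx, h.vz, h.vy, h.xz, h.xy, h.yz.symm, h.px, h.rz, h.qy, h.npz, h.npy, h.nrx, h.nry,
    h.nqx, h.nqz, fun w hw => by have := h.cover w hw; tauto⟩

/-- A neighbour of the apex adjacent to the first vertex, outside the first clique. -/
theorem PrismAt.eq_x {V : Type*} {G : SimpleGraph V} {v p q r x y z t : V}
    (h : PrismAt G v p q r x y z) (h1 : G.Adj v t) (h2 : G.Adj p t) (hq : t ≠ q) (hr : t ≠ r) :
    t = x := by
  have h3 := h.npy
  have h4 := h.npz
  rcases h.cover t h1 with h | h | h | h | h | h <;> subst h <;> simp_all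

/-- A new prism at an end of an existing one meets it in the expected vertex. -/
theorem PrismAt.first_eq {V : Type*} {G : SimpleGraph V} {v p q r x y z t y' z' : V}
    (hqr : G.Adj q r)
    (h : PrismAt G v p q r x y z) (h' : PrismAt G p v q r t y' z') : t = x := by
  refine h.eq_x h'.px h'.vx ?_ ?_
  · rintro rfl
    exact h'.nrx hqr.symm
  · rintro rfl
    exact h'.nqx hqr

/-- The vertex `c` opposite to an edge `p q` of a four-clique `v p q r` is well defined. -/
theorem PrismAt.second_eq {V : Type*} {G : SimpleGraph V} {v p q r x y c c' z z' : V}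
    (hvr : G.Adj v r)
    (h : PrismAt G p v q r x c z) (h' : PrismAt G q v p r y c' z') : c = c' := by
  refine h'.swap12.eq_x h.qy h.vy ?_ ?_
  · rintro rfl
    exact h.nry hvr.symm
  · rintro rfl
    exact h.npy hvr

/-- Six distinct neighbours of a vertex are all of its neighbours. -/
theorem mem_of_six {V : Type*} (G : SimpleGraph V)
    (hloc : ∀ v : V, Nonempty ((G.induce (G.neighborSet v)) ≃g rookGraph))
    (v : V) (l : List V) (hl : l.length = 6) (hn : l.Nodup) (h : ∀ x ∈ l, G.Adj v x)
    (w : V) (hw : G.Adj v w) : w ∈ l := by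
  classical
  obtain ⟨f⟩ := hloc v
  have hfin : Finite (G.neighborSet v) := Finite.of_equiv _ f.symm.toEquiv
  have hcard : (G.neighborSet v).ncard = 6 := by
    rw [← Nat.card_coe_set_eq, Nat.card_congr f.toEquiv]
    simp
  have hsub : (l.toFinset : Set V) ⊆ G.neighborSet v := by
    intro x hx
    exact h x (by simpa using hx)
  have heq := Set.eq_of_subset_of_ncard_le hsub (by
    rw [hcard, Set.ncard_coe_finset, List.toFinset_card_of_nodup hn, hl]) (Set.toFinite _)
  have : w ∈ (l.toFinset : Set V) := by
    rw [heq]; exact hw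
  simpa using this

theorem locally_rook_card_ten {V : Type*} (G : SimpleGraph V)
    (hconn : G.Connected)
    (hloc : ∀ v : V, Nonempty ((G.induce (G.neighborSet v)) ≃g rookGraph)) :
    Nat.card V = 10 := by
  classical
  obtain ⟨v⟩ := hconn.nonempty
  obtain ⟨a0, a1, a2, va0, va1, va2, a01, a02, a12⟩ := exists_base G hloc v
  obtain ⟨b0, b1, b2, P⟩ := exists_prism G hloc v a0 a1 a2 va0 va1 va2 a01 a02 a12
  obtain ⟨t, c01, c02, P0⟩ := exists_prism G hloc a0 v a1 a2 va0.symm a01 a02 va1 va2 a12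
  obtain rfl := P.first_eq a12 P0
  obtain ⟨t', c01', c12, P1⟩ := exists_prism G hloc a1 v a0 a2 va1.symm a01.symm a12 va0 va2 a02
  obtain rfl := P.swap12.first_eq a02 P1
  obtain ⟨t'', c02', c12', P2⟩ :=
    exists_prism G hloc a2 v a0 a1 va2.symm a02.symm a12.symm va0 va1 a01
  obtain rfl := P.swap23.swap12.first_eq a01 P2
  obtain rfl := P0.second_eq va2 P1
  obtain rfl := P0.swap23.second_eq va1 P2
  obtain rfl := P1.swap23.second_eq va0 P2.swap23
  have nd : ([v, a0, a1, a2, t, t', t'', c01, c02, c12] : List V).Nodup := by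
    have irr := fun a => G.irrefl (v := a)
    have sy := fun a b => G.adj_comm a b
    obtain ⟨_, _, _, _, _, _, _, _, _, _, _, _, _, _, _, _⟩ := P
    obtain ⟨_, _, _, _, _, _, _, _, _, _, _, _, _, _, _, _⟩ := P0
    obtain ⟨_, _, _, _, _, _, _, _, _, _, _, _, _, _, _, _⟩ := P1
    obtain ⟨_, _, _, _, _, _, _, _, _, _, _, _, _, _, _, _⟩ := P2
    simp only [List.nodup_cons, List.mem_cons, List.not_mem_nil, or_false, not_or]
    refine ⟨⟨?_, ?_, ?_, ?_, ?_, ?_, ?_, ?_, ?_⟩, ⟨?_, ?_, ?_, ?_, ?_, ?_, ?_, ?_⟩,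
      ⟨?_, ?_, ?_, ?_, ?_, ?_, ?_⟩, ⟨?_, ?_, ?_, ?_, ?_, ?_⟩, ⟨?_, ?_, ?_, ?_, ?_⟩,
      ⟨?_, ?_, ?_, ?_⟩, ⟨?_, ?_, ?_⟩, ⟨?_, ?_⟩, ?_, by simp⟩ <;> rintro rfl <;> grind
  have cl : ∀ u w, u ∈ ([v, a0, a1, a2, t, t', t'', c01, c02, c12] : List V) → G.Adj u w →
      w ∈ ([v, a0, a1, a2, t, t', t'', c01, c02, c12] : List V) := by
    intro u w hu hw
    simp only [List.mem_cons, List.not_mem_nil, or_false] at hu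
    have hb : ∀ l : List V, l.length = 6 → l.Nodup → (∀ x ∈ l, G.Adj u x) →
        l ⊆ [v, a0, a1, a2, t, t', t'', c01, c02, c12] →
        w ∈ [v, a0, a1, a2, t, t', t'', c01, c02, c12] :=
      fun l h1 h2 h3 h4 => h4 (mem_of_six G hloc u l h1 h2 h3 w hw)
    rcases hu with rfl | rfl | rfl | rfl | rfl | rfl | rfl | rfl | rfl | rfl
    · have := P.cover w hw
      clear nd; simp only [List.mem_cons]; grind
    · have := P0.cover w hw
      clear nd; simp only [List.mem_cons]; grind
    · have := P1.cover w hw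
      clear nd; simp only [List.mem_cons]; grind
    · have := P2.cover w hw
      clear nd; simp only [List.mem_cons]; grind
    · refine hb [v, a0, t', t'', c01, c02] rfl ?_ ?_ ?_
      · exact nd.sublist (by
          repeat (first | exact List.Sublist.slnil | apply List.Sublist.cons_cons |
            apply List.Sublist.cons))
      · simp [P.vx.symm, P.px.symm, P.xy, P.xz, P0.xy, P0.xz]
      · simp
    · refine hb [v, a1, t, t'', c01, c12] rfl ?_ ?_ ?_
      · exact nd.sublist (by
          repeat (first | exact List.Sublist.slnil | apply List.Sublist.cons_cons |
            apply List.Sublist.cons))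
      · simp [P.vy.symm, P.qy.symm, P.xy.symm, P.yz, P1.xy, P1.xz]
      · simp
    · refine hb [v, a2, t, t', c02, c12] rfl ?_ ?_ ?_
      · exact nd.sublist (by
          repeat (first | exact List.Sublist.slnil | apply List.Sublist.cons_cons |
            apply List.Sublist.cons))
      · simp [P.vz.symm, P.rz.symm, P.xz.symm, P.yz.symm, P2.xy, P2.xz]
      · simp
    · refine hb [a0, a1, t, t', c02, c12] rfl ?_ ?_ ?_
      · exact nd.sublist (by
          repeat (first | exact List.Sublist.slnil | apply List.Sublist.cons_cons |
            apply List.Sublist.cons))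
      · simp [P0.vy.symm, P1.vy.symm, P0.xy.symm, P1.xy.symm, P0.yz, P1.yz]
      · simp
    · refine hb [a0, a2, t, t'', c01, c12] rfl ?_ ?_ ?_
      · exact nd.sublist (by
          repeat (first | exact List.Sublist.slnil | apply List.Sublist.cons_cons |
            apply List.Sublist.cons))
      · simp [P0.vz.symm, P2.vy.symm, P0.xz.symm, P2.xy.symm, P0.yz.symm, P2.yz]
      · simp
    · refine hb [a1, a2, t', t'', c01, c02] rfl ?_ ?_ ?_
      · exact nd.sublist (by
          repeat (first | exact List.Sublist.slnil | apply List.Sublist.cons_cons |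
            apply List.Sublist.cons))
      · simp [P1.vz.symm, P2.vz.symm, P1.xz.symm, P2.xz.symm, P1.yz.symm, P2.yz.symm]
      · simp
  have all : ∀ w, w ∈ ([v, a0, a1, a2, t, t', t'', c01, c02, c12] : List V) := by
    intro w
    obtain ⟨p⟩ := hconn.preconnected v w
    have : ∀ u w, G.Walk u w → u ∈ ([v, a0, a1, a2, t, t', t'', c01, c02, c12] : List V) →
      w ∈ ([v, a0, a1, a2, t, t', t'', c01, c02, c12] : List V) := by
      intro u w p
      induction p with
      | nil => exact id
      | cons h _ ih => exact fun hu => ih (cl _ _ hu h)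
    exact this v w p (by simp)
  have e : (Set.univ : Set V) =
      (([v, a0, a1, a2, t, t', t'', c01, c02, c12] : List V).toFinset : Set V) := by
    ext w; simpa using all w
  rw [← Set.ncard_univ, e, Set.ncard_coe_finset, List.toFinset_card_of_nodup nd]
  rfl
end

section
/- The Johnson graph J(5,2) is connected and is locally the Rook graph K3 □ K2: for every vertex v of J(5,2), the subgraph induced on the neighborhood of v is isomorphic to K3 □ K2. -/
open SimpleGraph

/-- The neighbour of `s` in row `p.1` (an element outside `s`), column `p.2` (an element of `s`). -/
def rookNbr (s : Finset (Fin 5)) (p : Fin 3 × Fin 2) : Finset (Fin 5) :=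
  {((List.finRange 5).filter (fun x => x ∉ s)).getD p.1.val 0,
    ((List.finRange 5).filter (fun x => x ∈ s)).getD p.2.val 0}

set_option maxRecDepth 100000 in
theorem rookNbr_spec : ∀ s : Finset (Fin 5), s.card = 2 → ∀ p,
    (rookNbr s p).card = 2 ∧ s ≠ rookNbr s p ∧ (s ∩ rookNbr s p).Nonempty := by
  decide +kernel

set_option maxRecDepth 100000 in
theorem rookNbr_inj : ∀ s : Finset (Fin 5), s.card = 2 → ∀ p q,
    rookNbr s p = rookNbr s q → p = q := by
  decide +kernel

set_option maxRecDepth 100000 in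
theorem rookNbr_surj : ∀ s : Finset (Fin 5), s.card = 2 → ∀ t : Finset (Fin 5), t.card = 2 →
    s ≠ t → (s ∩ t).Nonempty → ∃ p, rookNbr s p = t := by
  decide +kernel

set_option maxRecDepth 100000 in
theorem rookNbr_adj : ∀ s : Finset (Fin 5), s.card = 2 → ∀ p q : Fin 3 × Fin 2,
    (rookNbr s p ≠ rookNbr s q ∧ (rookNbr s p ∩ rookNbr s q).Nonempty) ↔
      (p.1 ≠ q.1 ∧ p.2 = q.2 ∨ p.2 ≠ q.2 ∧ p.1 = q.1) := by
  decide +kernel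

set_option maxRecDepth 100000 in
theorem johnson_two_steps : ∀ s : Finset (Fin 5), s.card = 2 → ∀ t : Finset (Fin 5), t.card = 2 →
    ∃ u : Finset (Fin 5), u.card = 2 ∧ (s ∩ u).Nonempty ∧ (u ∩ t).Nonempty := by
  decide +kernel

theorem johnson_adj_iff (a b : {s : Finset (Fin 5) // s.card = 2}) :
    johnsonGraph52.Adj a b ↔ a.1 ≠ b.1 ∧ (a.1 ∩ b.1).Nonempty := by
  simp only [johnsonGraph52, SimpleGraph.fromRel_adj, ne_eq, Subtype.ext_iff,
    Finset.inter_comm b.1 a.1, or_self]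

theorem johnson_reach (a b : {s : Finset (Fin 5) // s.card = 2}) (h : (a.1 ∩ b.1).Nonempty) :
    johnsonGraph52.Reachable a b := by
  by_cases hab : a = b
  · rw [hab]
  · exact SimpleGraph.Adj.reachable
      ((johnson_adj_iff a b).2 ⟨fun h' => hab (Subtype.ext h'), h⟩)

/-- The Johnson graph `J(5,2)` is connected and locally the Rook graph `K3 □ K2`. -/
theorem johnson_connected_and_locally_rook :
    johnsonGraph52.Connected ∧
      ∀ v, Nonempty ((johnsonGraph52.induce (johnsonGraph52.neighborSet v)) ≃g rookGraph) := by
  refine ⟨?_, fun v => ?_⟩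
  · haveI : Nonempty {s : Finset (Fin 5) // s.card = 2} := ⟨⟨{0, 1}, by decide⟩⟩
    refine SimpleGraph.Connected.mk fun a b => ?_
    obtain ⟨u, hu, h1, h2⟩ := johnson_two_steps a.1 a.2 b.1 b.2
    exact (johnson_reach a ⟨u, hu⟩ h1).trans (johnson_reach ⟨u, hu⟩ b h2)
  · let f : Fin 3 × Fin 2 → johnsonGraph52.neighborSet v := fun p =>
      ⟨⟨rookNbr v.1 p, (rookNbr_spec v.1 v.2 p).1⟩,
        (johnson_adj_iff _ _).2 (rookNbr_spec v.1 v.2 p).2⟩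
    have hf : Function.Bijective f := by
      constructor
      · intro p q h
        exact rookNbr_inj v.1 v.2 p q (congrArg (fun x => x.1.1) h)
      · rintro ⟨w, hw⟩
        have hw' := (johnson_adj_iff v w).1 hw
        obtain ⟨p, hp⟩ := rookNbr_surj v.1 v.2 w.1 w.2 hw'.1 hw'.2
        exact ⟨p, Subtype.ext (Subtype.ext hp)⟩
    refine ⟨RelIso.symm ⟨Equiv.ofBijective f hf, ?_⟩⟩
    intro p q
    have h1 := rookNbr_adj v.1 v.2 p q
    have h2 : rookGraph.Adj p q ↔ (p.1 ≠ q.1 ∧ p.2 = q.2 ∨ p.2 ≠ q.2 ∧ p.1 = q.1) := by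
      simp [rookGraph, SimpleGraph.boxProd_adj]
    rw [h2, ← h1]
    exact johnson_adj_iff (f p).1 (f q).1
end

section
/- If a connected simple graph G is locally the octahedron graph K_{2,2,2} (the complete tripartite graph with all parts of size 2), then G is isomorphic to the 16-cell graph K_{2,2,2,2} (the complete multipartite graph with four parts of size 2), which is the 1-skeleton of the 4-dimensional hyperoctahedron. -/
open SimpleGraph

/-- The octahedron graph `K_{2,2,2}`: the complete tripartite graph with all
parts of size 2. -/
def octahedronGraph : SimpleGraph ((_ : Fin 3) × Fin 2) :=
  SimpleGraph.completeMultipartiteGraph (fun _ : Fin 3 => Fin 2)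

/-- The 16-cell graph `K_{2,2,2,2}`: the complete multipartite graph with four
parts of size 2, the 1-skeleton of the 4-dimensional hyperoctahedron. -/
def sixteenCellGraph : SimpleGraph ((_ : Fin 4) × Fin 2) :=
  SimpleGraph.completeMultipartiteGraph (fun _ : Fin 4 => Fin 2)

lemma octa_adj (a b : (_ : Fin 3) × Fin 2) : octahedronGraph.Adj a b ↔ a.1 ≠ b.1 := by
  simp [octahedronGraph, completeMultipartiteGraph]

lemma sixteen_adj (a b : (_ : Fin 4) × Fin 2) : sixteenCellGraph.Adj a b ↔ a.1 ≠ b.1 := by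
  simp [sixteenCellGraph, completeMultipartiteGraph]

lemma octa_anti : ∀ a : (_ : Fin 3) × Fin 2, ∃ a' : (_ : Fin 3) × Fin 2,
    a' ≠ a ∧ a'.1 = a.1 ∧ ∀ b : (_ : Fin 3) × Fin 2, b ≠ a → a.1 = b.1 → b = a' := by
  decide

lemma octa_common : ∀ a b : (_ : Fin 3) × Fin 2, ∃ c : (_ : Fin 3) × Fin 2,
    a.1 ≠ c.1 ∧ b.1 ≠ c.1 := by
  decide

/-- Inside the neighbourhood of `x`, each vertex has a unique other non-neighbour. -/
lemma local_anti {V : Type*} (G : SimpleGraph V)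
    (hloc : ∀ v : V, Nonempty ((G.induce (G.neighborSet v)) ≃g octahedronGraph))
    {x a : V} (h : G.Adj x a) :
    ∃ a', G.Adj x a' ∧ a' ≠ a ∧ ¬ G.Adj a a' ∧
      ∀ b, G.Adj x b → b ≠ a → ¬ G.Adj a b → b = a' := by
  obtain ⟨f⟩ := hloc x
  obtain ⟨c, h1, h2, h3⟩ := octa_anti (f ⟨a, h⟩)
  have key : ∀ b (hb : G.Adj x b), G.Adj a b ↔ (f ⟨a, h⟩).1 ≠ (f ⟨b, hb⟩).1 := by
    intro b hb
    rw [← octa_adj, f.map_adj_iff]; simp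
  refine ⟨(f.symm c).1, (f.symm c).2, ?_, ?_, ?_⟩
  · intro e
    apply h1
    have : f.symm c = ⟨a, h⟩ := Subtype.ext e
    rw [← this]; simp
  · rw [key _ (f.symm c).2]
    simp [h2]
  · intro b hb hne hadj
    rw [key b hb, not_not] at hadj
    have := h3 (f ⟨b, hb⟩) (fun e => hne (congrArg Subtype.val (f.injective e))) hadj
    rw [← this]; simp

lemma local_common {V : Type*} (G : SimpleGraph V)
    (hloc : ∀ v : V, Nonempty ((G.induce (G.neighborSet v)) ≃g octahedronGraph))
    {x a b : V} (ha : G.Adj x a) (hb : G.Adj x b) :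
    ∃ c, G.Adj x c ∧ G.Adj a c ∧ G.Adj b c := by
  obtain ⟨f⟩ := hloc x
  obtain ⟨c, h1, h2⟩ := octa_common (f ⟨a, ha⟩) (f ⟨b, hb⟩)
  have key : ∀ b (hb : G.Adj x b), (f ⟨b, hb⟩).1 ≠ c.1 → G.Adj b (f.symm c).1 := by
    intro b hb h
    have : octahedronGraph.Adj (f ⟨b, hb⟩) (f (f.symm c)) := by
      rw [octa_adj]; simpa using h
    rw [f.map_adj_iff] at this
    simpa using this
  exact ⟨(f.symm c).1, (f.symm c).2, key a ha h1, key b hb h2⟩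

/-- If `p` is a common neighbour of the distinct non-adjacent `v`, `w`, then `w` is adjacent
to every neighbour of `v`. -/
lemma nbr_sub {V : Type*} (G : SimpleGraph V)
    (hloc : ∀ v : V, Nonempty ((G.induce (G.neighborSet v)) ≃g octahedronGraph))
    {v w p : V} (hvp : G.Adj v p) (hwp : G.Adj w p) (hne : w ≠ v)
    (hn : ¬ G.Adj v w) : ∀ q, G.Adj v q → G.Adj w q := by
  have step : ∀ p q, G.Adj v p → G.Adj w p → G.Adj v q → G.Adj p q → G.Adj w q := by
    intro p q h1 h2 h3 h4
    by_contra h5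
    obtain ⟨a, -, -, -, ha⟩ := local_anti G hloc h2.symm
    have e1 := ha v h1.symm hne.symm (fun h => hn h.symm)
    have e2 := ha q h4 (fun e => hn (e ▸ h3)) h5
    exact h3.ne (e1.trans e2.symm)
  intro q hq
  obtain ⟨c, hc, hpc, hqc⟩ := local_common G hloc hvp hq
  exact step c q hc (step p c hvp hwp hc hpc) hq hqc.symm

theorem locally_octahedron_iso_sixteenCell {V : Type*} (G : SimpleGraph V)
    (hconn : G.Connected)
    (hloc : ∀ v : V, Nonempty ((G.induce (G.neighborSet v)) ≃g octahedronGraph)) :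
    Nonempty (G ≃g sixteenCellGraph) := by
  obtain ⟨v⟩ := hconn.nonempty
  obtain ⟨f⟩ := hloc v
  obtain ⟨p, hp⟩ : ∃ p, G.Adj v p := ⟨_, (f.symm ⟨0, 0⟩).2⟩
  obtain ⟨w, hpw, hwv, hvw, -⟩ := local_anti G hloc hp.symm
  have hsub := nbr_sub G hloc hp hpw.symm hwv hvw
  have hsup := nbr_sub G hloc hpw.symm hp hwv.symm (fun h => hvw h.symm)
  have hall : ∀ x, x = v ∨ x = w ∨ G.Adj v x := by
    intro x
    obtain ⟨W⟩ := hconn.preconnected x v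
    induction W with
    | nil => exact Or.inl rfl
    | @cons a b c hab _ ih =>
      rcases ih f hp hwv hvw hsub hsup with h | h | h
      · subst h; exact Or.inr (Or.inr hab.symm)
      · subst h; exact Or.inr (Or.inr (hsup _ hab.symm))
      · by_contra hcon
        push Not at hcon
        obtain ⟨z, -, -, -, hz⟩ := local_anti G hloc h.symm
        have e1 := hz a hab.symm hcon.1 hcon.2.2
        have e2 := hz w (hsub _ h).symm hwv hvw
        exact hcon.2.1 (e1.trans e2.symm)
  let g : ((_ : Fin 4) × Fin 2) → V := fun x =>
    Fin.cases (motive := fun _ => V) (if x.2 = 0 then v else w)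
      (fun k => (f.symm ⟨k, x.2⟩).1) x.1
  have g0 : g ⟨0, 0⟩ = v := rfl
  have g1 : g ⟨0, 1⟩ = w := rfl
  have gs : ∀ k j, g ⟨Fin.succ k, j⟩ = (f.symm ⟨k, j⟩).1 := fun k j => rfl
  have gv : ∀ k j, G.Adj v (f.symm ⟨k, j⟩).1 := fun k j => (f.symm ⟨k, j⟩).2
  have gw : ∀ k j, G.Adj w (f.symm ⟨k, j⟩).1 := fun k j => hsub _ (gv k j)
  have hgadj : ∀ a b, G.Adj (g a) (g b) ↔ sixteenCellGraph.Adj a b := by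
    rintro ⟨i, j⟩ ⟨k, l⟩
    rw [sixteen_adj]
    have hwv' : ¬ G.Adj w v := fun h => hvw h.symm
    induction i using Fin.cases with
    | zero =>
      induction k using Fin.cases with
      | zero => fin_cases j <;> fin_cases l <;> simp [g0, g1, hvw, hwv']
      | succ k =>
        rw [gs]
        fin_cases j <;> simp [g0, g1, gv, gw, (Fin.succ_ne_zero k).symm]
    | succ i =>
      induction k using Fin.cases with
      | zero =>
        rw [gs, G.adj_comm]
        fin_cases l <;> simp [g0, g1, gv, gw]
      | succ k =>
        rw [gs, gs]
        have := f.symm.map_adj_iff (v := ⟨i, j⟩) (w := ⟨k, l⟩)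
        rw [octa_adj] at this
        simpa using this
  have hinj : Function.Injective g := by
    rintro ⟨i, j⟩ ⟨k, l⟩ h
    induction i using Fin.cases with
    | zero =>
      induction k using Fin.cases with
      | zero =>
        fin_cases j <;> fin_cases l <;> simp [g0, g1, hwv, hwv.symm] at h ⊢
      | succ k =>
        rw [gs] at h
        have h1 := gv k l
        have h2 := gw k l
        rw [← h] at h1 h2
        fin_cases j
        · exact (G.loopless.irrefl _ h1).elim
        · exact (G.loopless.irrefl _ h2).elim
    | succ i =>
      induction k using Fin.cases with
      | zero =>
        rw [gs] at h
        have h1 := gv i j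
        have h2 := gw i j
        rw [h] at h1 h2
        fin_cases l
        · exact (G.loopless.irrefl _ h1).elim
        · exact (G.loopless.irrefl _ h2).elim
      | succ k =>
        rw [gs, gs] at h
        have := f.symm.injective (Subtype.ext h)
        simp at this
        simp [this]
  have hsurj : Function.Surjective g := by
    intro x
    rcases hall x with h | h | h
    · exact ⟨_, g0.trans h.symm⟩
    · exact ⟨_, g1.trans h.symm⟩
    · refine ⟨⟨Fin.succ (f ⟨x, h⟩).1, (f ⟨x, h⟩).2⟩, ?_⟩
      rw [gs]; simp
  let e : sixteenCellGraph ≃g G :=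
    { toEquiv := Equiv.ofBijective g ⟨hinj, hsurj⟩
      map_rel_iff' := by intro a b; exact hgadj a b }
  exact ⟨e.symm⟩
end

section
/- Any two connected simple graphs that are locally the 5-cycle C5 are isomorphic to each other. (The unique such graph is the 1-skeleton of the icosahedron.) -/
open SimpleGraph

namespace LocC5

/-- The link of `v` is the induced 5-cycle `x y z p q`. -/
structure Link {V : Type*} (G : SimpleGraph V) (v x y z p q : V) : Prop where
  mem : ∀ u, G.Adj v u ↔ u = x ∨ u = y ∨ u = z ∨ u = p ∨ u = q
  xy : G.Adj x y
  yz : G.Adj y z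
  zp : G.Adj z p
  pq : G.Adj p q
  qx : G.Adj q x
  xz : ¬ G.Adj x z
  yp : ¬ G.Adj y p
  zq : ¬ G.Adj z q
  px : ¬ G.Adj p x
  qy : ¬ G.Adj q y

lemma cyc : ∀ i j : Fin 5, (cycleGraph 5).Adj i j ↔ (j = i + 1 ∨ i = j + 1) := by
  decide

lemma cyc_path (i j : Fin 5) (h : j = i + 1 ∨ i = j + 1) : ∃ z p q : Fin 5,
    (∀ u, u = i ∨ u = j ∨ u = z ∨ u = p ∨ u = q) ∧
    (z = j + 1 ∨ j = z + 1) ∧ (p = z + 1 ∨ z = p + 1) ∧ (q = p + 1 ∨ p = q + 1) ∧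
    (i = q + 1 ∨ q = i + 1) ∧ ¬ (z = i + 1 ∨ i = z + 1) ∧ ¬ (p = j + 1 ∨ j = p + 1) ∧
    ¬ (q = z + 1 ∨ z = q + 1) ∧ ¬ (i = p + 1 ∨ p = i + 1) ∧ ¬ (j = q + 1 ∨ q = j + 1) := by
  rcases h with rfl | rfl
  · refine ⟨i + 2, i + 3, i + 4, ?_⟩
    revert i; decide
  · refine ⟨j + 4, j + 3, j + 2, ?_⟩
    revert j; decide

lemma exists_cycle {V : Type*} (G : SimpleGraph V) (v : V)
    (h : Nonempty ((G.induce (G.neighborSet v)) ≃g cycleGraph 5)) :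
    ∃ a : Fin 5 → V, Function.Injective a ∧ (∀ u, G.Adj v u ↔ ∃ i, u = a i) ∧
      ∀ i j, G.Adj (a i) (a j) ↔ (j = i + 1 ∨ i = j + 1) := by
  obtain ⟨e⟩ := h
  refine ⟨fun i => (e.symm i : V), ?_, ?_, ?_⟩
  · intro i j hij
    exact e.symm.injective (Subtype.ext hij)
  · intro u
    constructor
    · intro hu
      exact ⟨e ⟨u, hu⟩, by simp⟩
    · rintro ⟨i, rfl⟩
      exact (e.symm i).2
  · intro i j
    rw [← cyc, ← e.symm.map_adj_iff]
    rfl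

lemma exists_link {V : Type*} (G : SimpleGraph V) (v : V)
    (h : Nonempty ((G.induce (G.neighborSet v)) ≃g cycleGraph 5)) (x y : V)
    (hx : G.Adj v x) (hy : G.Adj v y) (hxy : G.Adj x y) :
    ∃ z p q, Link G v x y z p q := by
  obtain ⟨a, -, hm, ha⟩ := exists_cycle G v h
  obtain ⟨i, rfl⟩ := (hm x).1 hx
  obtain ⟨j, rfl⟩ := (hm y).1 hy
  obtain ⟨z, p, q, h0, h1, h2, h3, h4, h5, h6, h7, h8, h9⟩ := cyc_path i j ((ha i j).1 hxy)
  refine ⟨a z, a p, a q, ?_, hxy, ?_, ?_, ?_, ?_, ?_, ?_, ?_, ?_, ?_⟩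
  · intro u
    rw [hm]
    constructor
    · rintro ⟨k, rfl⟩
      rcases h0 k with h | h | h | h | h <;> simp [h]
    · rintro (h | h | h | h | h) <;> exact ⟨_, h⟩
  all_goals rw [ha]; assumption

/-- Vertices of the icosahedron. -/
inductive Ico where
  | v : Ico
  | c : Ico
  | a : Fin 5 → Ico
  | b : Fin 5 → Ico

/-- Adjacency of the icosahedron. -/
def Ico.adj : Ico → Ico → Prop
  | .v, .a _ => True
  | .a _, .v => True
  | .a i, .a j => j = i + 1 ∨ i = j + 1
  | .a i, .b j => i = j ∨ i = j + 1
  | .b j, .a i => i = j ∨ i = j + 1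
  | .b i, .b j => j = i + 1 ∨ i = j + 1
  | .b _, .c => True
  | .c, .b _ => True
  | _, _ => False

lemma f2 (i : Fin 5) : i + 1 + 1 = i + 2 := by revert i; decide
lemma f3 (i : Fin 5) : i + 2 + 1 = i + 3 := by revert i; decide
lemma f3' (i : Fin 5) : i + 1 + 2 = i + 3 := by revert i; decide
lemma f5 (i : Fin 5) : i + 4 + 1 = i := by revert i; decide
lemma f7 (i : Fin 5) : i + 3 + 2 = i := by revert i; decide
lemma f6 (i : Fin 5) : i + 4 + 2 = i + 1 := by revert i; decide
lemma d3 (i j : Fin 5) : j = i ∨ j = i + 1 ∨ j = i + 2 ∨ j = i + 3 ∨ j = i + 4 := by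
  revert i j; decide

theorem structure_thm {V : Type*} (G : SimpleGraph V) (hconn : G.Connected)
    (hloc : ∀ v : V, Nonempty ((G.induce (G.neighborSet v)) ≃g cycleGraph 5)) :
    ∃ f : Ico → V, Function.Bijective f ∧ ∀ i j, G.Adj (f i) (f j) ↔ i.adj j := by
  obtain ⟨v⟩ := hconn.nonempty
  obtain ⟨a, ainj, hv, haa⟩ := exists_cycle G v (hloc v)
  have hva : ∀ i, G.Adj v (a i) := fun i => (hv _).2 ⟨i, rfl⟩
  have haS : ∀ i, G.Adj (a i) (a (i + 1)) := fun i => (haa _ _).2 (Or.inl rfl)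
  have H1 : ∀ i, ∃ z p, Link G (a (i + 1)) v (a (i + 2)) z p (a i) := by
    intro i
    obtain ⟨z, p, q, L⟩ := exists_link G (a (i + 1)) (hloc _) v (a (i + 2))
      (hva _).symm (by rw [← f2]; exact haS _) (hva _)
    obtain ⟨j, rfl⟩ := (hv q).1 L.qx.symm
    have h1 : G.Adj (a (i + 1)) (a j) := (L.mem _).2 (by simp)
    have : j = i := by
      rcases (haa _ _).1 h1 with h | h
      · rw [f2] at h
        subst h
        exact absurd L.yz.symm L.zq
      · exact (add_right_cancel h).symm
    subst this
    exact ⟨z, p, L⟩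
  choose b' p L0 using H1
  obtain ⟨b, hb⟩ : ∃ b : Fin 5 → V, ∀ i, b (i + 1) = b' i :=
    ⟨fun i => b' (i + 4), fun i => by
      show b' (i + 1 + 4) = _
      congr 1; revert i; decide⟩
  have hp : ∀ i, p (i + 1) = b (i + 1) := by
    intro i
    have A := L0 i
    have B := L0 (i + 1)
    rw [f2, f3'] at B
    rw [hb]
    have m : G.Adj (a (i + 2)) (b' i) := A.yz
    have m1 : G.Adj (a (i + 1)) (b' i) := (A.mem _).2 (by simp)
    have hnv := A.xz
    rcases (B.mem _).1 m with h | h | h | h | h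
    · exact absurd (h ▸ A.zp) (fun h' => A.px h'.symm)
    · exact absurd (h ▸ hva _) hnv
    · exact absurd (h ▸ m1).symm B.zq
    · exact h.symm
    · exact absurd (h ▸ hva _) hnv
  have hp' : ∀ i, p i = b i := by
    intro i
    have := hp (i + 4)
    rwa [f5] at this
  have L : ∀ i, Link G (a (i + 1)) v (a (i + 2)) (b (i + 1)) (b i) (a i) := by
    intro i
    have := L0 i
    rwa [← hb, hp'] at this
  clear hp hp' hb L0
  have hvb : ∀ i, ¬ G.Adj v (b i) := fun i h => (L i).px h.symm
  have hbb : ∀ i, G.Adj (b (i + 1)) (b i) := fun i => (L i).zp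
  have hba : ∀ i, G.Adj (b i) (a i) := fun i => (L i).pq
  have hba' : ∀ i, G.Adj (b i) (a (i + 1)) := fun i => ((L i).mem (b i)).2 (by simp) |>.symm
  have hn1 : ∀ i, ¬ G.Adj (b i) (a (i + 2)) := fun i h => (L i).yp h.symm
  have hn2 : ∀ i, ¬ G.Adj (b (i + 1)) (a i) := fun i => (L i).zq
  -- links of the `b`
  have H2 : ∀ i, ∃ c, Link G (b (i + 1)) (a (i + 1)) (a (i + 2)) (b (i + 2)) c (b i) := by
    intro i
    have e1 : G.Adj (b (i + 1)) (a (i + 2)) := by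
      have := hba' (i + 1); rwa [f2] at this
    have e2 : G.Adj (a (i + 1)) (a (i + 2)) := by
      have := haS (i + 1); rwa [f2] at this
    have e3 : G.Adj (b (i + 2)) (b (i + 1)) := by
      have := hbb (i + 1); rwa [f2] at this
    have e4 : ¬ G.Adj (b (i + 2)) (a (i + 1)) := by
      have := hn2 (i + 1); rwa [f2] at this
    obtain ⟨z, c, q, M⟩ := exists_link G (b (i + 1)) (hloc _) (a (i + 1)) (a (i + 2))
      (hba _) e1 e2
    have e5 := hba (i + 2)
    have e6 := hba' i
    have e7 := hn1 i
    have hz : b (i + 2) = z := by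
      rcases (M.mem _).1 e3.symm with h | h | h | h | h
      · exact absurd (h ▸ hva _) (hvb _)
      · exact absurd (h ▸ hva _) (hvb _)
      · exact h
      · exact absurd (h ▸ e5).symm M.yp
      · exact absurd (h ▸ e5) M.qy
    have hq : b i = q := by
      rcases (M.mem _).1 (hbb i) with h | h | h | h | h
      · exact absurd (h ▸ hva _) (hvb _)
      · exact absurd (h ▸ hva _) (hvb _)
      · exact absurd (h ▸ e6).symm M.xz
      · exact absurd (h ▸ e6) M.px
      · exact h
    subst hz hq
    exact ⟨c, M⟩
  choose c M using H2
  have hc : ∀ i, c (i + 1) = c i := by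
    intro i
    have A := M i
    have B := M (i + 1)
    rw [f2, f3'] at B
    have m : G.Adj (b (i + 2)) (c i) := A.zp
    have m1 : G.Adj (b (i + 1)) (c i) := (A.mem _).2 (by simp)
    rcases (B.mem _).1 m with h | h | h | h | h
    · exact absurd A.yz.symm (fun h' => A.yp (by
        have := B.px; have := A.mem (a (i+2)); exact absurd (h ▸ A.pq) (fun h'' => hn1 i h''.symm)))
    · exact absurd (h ▸ m1) (by have := hn1 (i + 1); rwa [f3'] at this)
    · exact absurd (h ▸ m1).symm B.zq
    · exact h.symm
    · exact absurd (h ▸ m1) (G.irrefl)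
  have hc0 : ∀ i, c i = c 0 := by
    have h0 := hc 0
    have h1 := hc 1
    have h2 := hc 2
    have h3 := hc 3
    intro i
    fin_cases i
    · rfl
    · exact h0
    · exact h1.trans h0
    · exact h2.trans (h1.trans h0)
    · exact h3.trans (h2.trans (h1.trans h0))
  generalize c 0 = d at hc0
  simp only [hc0] at M
  clear hc hc0
  have hdb : ∀ i, G.Adj d (b i) := fun i => (M i).pq
  have hda : ∀ i, ¬ G.Adj d (a i) := by
    intro i
    have := (M (i + 4)).px
    rwa [f5] at this
  have nva : ∀ i, v ≠ a i := fun i h => G.irrefl (h ▸ hva i)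
  have nab : ∀ i j, a i ≠ b j := fun i j h => hvb j (h ▸ hva i)
  have nvb : ∀ i, v ≠ b i := fun i h => hn1 i (h ▸ hva _)
  have ndv : d ≠ v := fun h => hda 0 (h ▸ hva 0)
  have ndb : ∀ i, d ≠ b i := fun i h => G.irrefl (h ▸ hdb i)
  have nda : ∀ i, d ≠ a i := fun i h => hda (i + 1) (h ▸ haS i)
  have nb1 : ∀ i, b (i + 1) ≠ b i := fun i => (hbb i).ne
  have nb2 : ∀ i, b (i + 2) ≠ b i := fun i h => hn1 i (h ▸ hba (i + 2))
  have binj : Function.Injective b := by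
    intro i j h
    rcases d3 i j with rfl | rfl | rfl | rfl | rfl
    · rfl
    · exact absurd h.symm (nb1 i)
    · exact absurd h.symm (nb2 i)
    · have := nb2 (i + 3)
      rw [f7] at this
      exact absurd h this
    · have := nb1 (i + 4)
      rw [f5] at this
      exact absurd h this
  have hd : ∀ u, G.Adj d u ↔ ∃ i, u = b i := by
    obtain ⟨e, einj, he, -⟩ := exists_cycle G d (hloc d)
    have : ∀ i, ∃ j, b i = e j := fun i => (he _).1 (hdb i)
    choose s hs using this
    have sinj : Function.Injective s := by
      intro i j h
      apply binj
      rw [hs, hs, h]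
    have ssurj := Finite.injective_iff_surjective.1 sinj
    intro u
    constructor
    · intro hu
      obtain ⟨j, rfl⟩ := (he u).1 hu
      obtain ⟨i, rfl⟩ := ssurj j
      exact ⟨i, (hs i).symm⟩
    · rintro ⟨i, rfl⟩
      exact hdb i
  have La : ∀ i u, G.Adj (a i) u ↔
      u = v ∨ u = a (i + 1) ∨ u = b i ∨ u = b (i + 4) ∨ u = a (i + 4) := by
    intro i
    have := (L (i + 4)).mem
    rwa [f5, f6] at this
  have Lb : ∀ i u, G.Adj (b i) u ↔
      u = a i ∨ u = a (i + 1) ∨ u = b (i + 1) ∨ u = d ∨ u = b (i + 4) := by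
    intro i
    have := (M (i + 4)).mem
    rwa [f5, f6] at this
  have c1 : ∀ i j : Fin 5, (j = i + 1 ∨ j = i + 4) ↔ (j = i + 1 ∨ i = j + 1) := by decide
  have c2 : ∀ i j : Fin 5, (j = i ∨ j = i + 4) ↔ (i = j ∨ i = j + 1) := by decide
  let f : Ico → V := fun x => match x with
    | .v => v
    | .c => d
    | .a i => a i
    | .b i => b i
  refine ⟨f, ⟨?_, ?_⟩, ?_⟩
  · rintro (_ | _ | i | i) (_ | _ | j | j) h <;> simp only [f] at h
    · rfl
    · exact absurd h.symm ndv
    · exact absurd h (nva _)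
    · exact absurd h (nvb _)
    · exact absurd h ndv
    · rfl
    · exact absurd h (nda _)
    · exact absurd h (ndb _)
    · exact absurd h.symm (nva _)
    · exact absurd h.symm (nda _)
    · rw [ainj h]
    · exact absurd h (nab _ _)
    · exact absurd h.symm (nvb _)
    · exact absurd h.symm (ndb _)
    · exact absurd h.symm (nab _ _)
    · rw [binj h]
  · have step : ∀ x y, G.Adj (f x) y → ∃ z, f z = y := by
      rintro (_ | _ | i | i) y h <;> simp only [f] at h
      · obtain ⟨j, rfl⟩ := (hv _).1 h
        exact ⟨.a j, rfl⟩
      · obtain ⟨j, rfl⟩ := (hd _).1 h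
        exact ⟨.b j, rfl⟩
      · rcases (La _ _).1 h with rfl | rfl | rfl | rfl | rfl
        exacts [⟨.v, rfl⟩, ⟨.a _, rfl⟩, ⟨.b _, rfl⟩, ⟨.b _, rfl⟩, ⟨.a _, rfl⟩]
      · rcases (Lb _ _).1 h with rfl | rfl | rfl | rfl | rfl
        exacts [⟨.a _, rfl⟩, ⟨.a _, rfl⟩, ⟨.b _, rfl⟩, ⟨.c, rfl⟩, ⟨.b _, rfl⟩]
    have walk : ∀ x y, G.Walk x y → (∃ z, f z = x) → ∃ z, f z = y := by
      intro x y w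
      induction w with
      | nil => exact id
      | cons h _ ih =>
        rintro ⟨z, rfl⟩
        exact ih (step _ _ h)
    intro y
    obtain ⟨w⟩ := hconn.preconnected v y
    exact walk v y w ⟨.v, rfl⟩
  · rintro (_ | _ | i | i) (_ | _ | j | j) <;> simp only [f, Ico.adj]
    · simp
    · simp [hv, nda]
    · simp [hva]
    · simp [hvb]
    · simp [hd, nvb]
    · simp
    · simp [hda]
    · simp [hdb]
    · simp [(hva i).symm]
    · simp [G.adj_comm, hda]
    · exact haa i j
    · rw [← c2]
      simp [La, binj.eq_iff, (nab _ _).symm, (nvb _).symm]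
    · simp [G.adj_comm, hvb]
    · simp [(hdb i).symm]
    · rw [G.adj_comm, ← c2]
      simp [La, binj.eq_iff, (nab _ _).symm, (nvb _).symm]
    · rw [← c1]
      simp [Lb, binj.eq_iff, (nab _ _).symm, (ndb _).symm]

end LocC5

/-- Any two connected graphs which are locally the 5-cycle `C5` are isomorphic
to each other (the unique such graph is the 1-skeleton of the icosahedron). -/
theorem locally_C5_unique {V W : Type*} (G : SimpleGraph V) (H : SimpleGraph W)
    (hGconn : G.Connected) (hHconn : H.Connected)
    (hGloc : ∀ v : V, Nonempty ((G.induce (G.neighborSet v)) ≃g cycleGraph 5))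
    (hHloc : ∀ w : W, Nonempty ((H.induce (H.neighborSet w)) ≃g cycleGraph 5)) :
    Nonempty (G ≃g H) := by
  obtain ⟨f, hf, hfa⟩ := LocC5.structure_thm G hGconn hGloc
  obtain ⟨g, hg, hga⟩ := LocC5.structure_thm H hHconn hHloc
  refine ⟨⟨(Equiv.ofBijective f hf).symm.trans (Equiv.ofBijective g hg), ?_⟩⟩
  intro x y
  obtain ⟨i, rfl⟩ := hf.2 x
  obtain ⟨j, rfl⟩ := hf.2 y
  have h1 : ∀ i, (Equiv.ofBijective f hf).symm (f i) = i :=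
    fun i => (Equiv.ofBijective f hf).symm_apply_apply i
  simp only [Equiv.trans_apply, h1, Equiv.ofBijective_apply, hfa, hga]
end

section
/- If a connected simple graph G is locally the 4-cycle C4, then G is isomorphic to the octahedron graph K_{2,2,2} (the complete multipartite graph with three parts of size 2). -/
open SimpleGraph

theorem local_C4 {V : Type*} (G : SimpleGraph V) (v : V)
    (h : Nonempty ((G.induce (G.neighborSet v)) ≃g cycleGraph 4)) :
    ∃ a b c d : V, G.Adj v a ∧ G.Adj v b ∧ G.Adj v c ∧ G.Adj v d ∧
      G.Adj a b ∧ G.Adj b c ∧ G.Adj c d ∧ G.Adj d a ∧ ¬ G.Adj a c ∧ ¬ G.Adj b d ∧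
      a ≠ c ∧ b ≠ d ∧ ∀ x, G.Adj v x → x = a ∨ x = b ∨ x = c ∨ x = d := by
  obtain ⟨e⟩ := h
  have key : ∀ i j : Fin 4, G.Adj (e.symm i).1 (e.symm j).1 ↔ (cycleGraph 4).Adj i j :=
    fun i j => e.symm.map_rel_iff (a := i) (b := j)
  have inj : ∀ i j : Fin 4, (e.symm i).1 = (e.symm j).1 → i = j :=
    fun i j hij => e.symm.injective (Subtype.ext hij)
  refine ⟨(e.symm 0).1, (e.symm 1).1, (e.symm 2).1, (e.symm 3).1,
    (e.symm 0).2, (e.symm 1).2, (e.symm 2).2, (e.symm 3).2,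
    (key _ _).2 (by decide), (key _ _).2 (by decide), (key _ _).2 (by decide),
    (key _ _).2 (by decide), fun h => absurd ((key _ _).1 h) (by decide),
    fun h => absurd ((key _ _).1 h) (by decide), fun h => absurd (inj _ _ h) (by decide),
    fun h => absurd (inj _ _ h) (by decide), ?_⟩
  intro x hx
  have hx' : x = (e.symm (e ⟨x, hx⟩)).1 := by simp
  generalize e ⟨x, hx⟩ = i at hx'
  fin_cases i <;> simp_all

theorem local_fourth {V : Type*} (G : SimpleGraph V)
    (hloc : ∀ v : V, Nonempty ((G.induce (G.neighborSet v)) ≃g cycleGraph 4))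
    {a v b d : V} (hv : G.Adj a v) (hb : G.Adj a b) (hd : G.Adj a d) (hbd : b ≠ d)
    (hvb : G.Adj v b) (hvd : G.Adj v d) :
    ∃ w, w ≠ v ∧ ¬ G.Adj v w ∧ G.Adj w b ∧ G.Adj w d ∧ G.Adj a w ∧
      ∀ x, G.Adj a x → x = v ∨ x = b ∨ x = w ∨ x = d := by
  obtain ⟨p, q, r, s, h1, h2, h3, h4, h5, h6, h7, h8, h9, h10, h11, h12, H⟩ :=
    local_C4 G a (hloc a)
  have irr := fun x => G.irrefl (v := x)
  have sy := fun x y => G.adj_comm x y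
  rcases H v hv with rfl | rfl | rfl | rfl
  · refine ⟨r, ?_⟩; grind
  · refine ⟨s, ?_⟩; grind
  · refine ⟨p, ?_⟩; grind
  · refine ⟨q, ?_⟩; grind

/-- A connected graph that is locally the 4-cycle `C4` is isomorphic to the
octahedron graph `K_{2,2,2}`. -/
theorem locally_C4_iso_octahedron {V : Type*} (G : SimpleGraph V)
    (hconn : G.Connected)
    (hloc : ∀ v : V, Nonempty ((G.induce (G.neighborSet v)) ≃g cycleGraph 4)) :
    Nonempty (G ≃g octahedronGraph) := by
  obtain ⟨v⟩ := hconn.nonempty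
  obtain ⟨a, b, c, d, va, vb, vc, vd, ab, bc, cd, da, nac, nbd, ac, bd, Hv⟩ :=
    local_C4 G v (hloc v)
  obtain ⟨w, wv, nvw, wb, wd, aw, Ha⟩ := local_fourth G hloc va.symm ab da.symm bd vb vd
  obtain ⟨w1, w1v, nvw1, w1a, w1c, bw1, Hb⟩ := local_fourth G hloc vb.symm ab.symm bc ac va vc
  obtain ⟨w2, w2v, nvw2, w2a, w2c, dw2, Hd⟩ := local_fourth G hloc vd.symm da cd.symm ac va vc
  obtain ⟨w3, w3v, nvw3, w3b, w3d, cw3, Hc⟩ := local_fourth G hloc vc.symm bc.symm cd bd vb vd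
  have e1 : w1 = w := by
    rcases Ha w1 w1a.symm with h | h | h | h
    · exact absurd h w1v
    · subst h; exact absurd bw1 G.irrefl
    · exact h
    · subst h; exact absurd bw1 nbd
  have e2 : w2 = w := by
    rcases Ha w2 w2a.symm with h | h | h | h
    · exact absurd h w2v
    · subst h; exact absurd dw2.symm nbd
    · exact h
    · subst h; exact absurd dw2 G.irrefl
  subst e1 e2
  have e3 : w3 = w2 := by
    rcases Hb w3 w3b.symm with h | h | h | h
    · exact absurd h w3v
    · subst h; exact absurd cw3.symm nac
    · exact h
    · subst h; exact absurd cw3 G.irrefl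
  subst e3
  obtain ⟨v', -, -, -, -, -, Hw⟩ := local_fourth G hloc aw.symm wb wd bd ab da.symm
  have Hw' : ∀ x, G.Adj w3 x → x = a ∨ x = b ∨ x = c ∨ x = d := by
    have := Hw c w1c
    have hcb := bc.ne
    have hcd := cd.ne
    intro x hx
    have := Hw x hx
    grind
  have all : ∀ x, x = v ∨ x = w3 ∨ x = a ∨ x = b ∨ x = c ∨ x = d := by
    have step : ∀ x y, G.Adj y x → (y = v ∨ y = w3 ∨ y = a ∨ y = b ∨ y = c ∨ y = d) →
        (x = v ∨ x = w3 ∨ x = a ∨ x = b ∨ x = c ∨ x = d) := by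
      intro x y hyx hy
      rcases hy with rfl | rfl | rfl | rfl | rfl | rfl
      · have := Hv x hyx; tauto
      · have := Hw' x hyx; tauto
      · have := Ha x hyx; tauto
      · have := Hb x hyx; tauto
      · have := Hc x hyx; tauto
      · have := Hd x hyx; tauto
    have walk : ∀ x y, G.Walk x y → (y = v ∨ y = w3 ∨ y = a ∨ y = b ∨ y = c ∨ y = d) →
        (x = v ∨ x = w3 ∨ x = a ∨ x = b ∨ x = c ∨ x = d) := by
      intro x y p
      induction p with
      | nil => exact id
      | cons h p ih => exact fun hy => step _ _ h.symm (ih hy)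
    intro x
    obtain ⟨p⟩ := hconn.preconnected x v
    exact walk x v p (Or.inl rfl)
  let f : ((_ : Fin 3) × Fin 2) → V := fun p => (![![v, w3], ![a, c], ![b, d]] p.1) p.2
  have hadj : ∀ p q, G.Adj (f p) (f q) ↔ octahedronGraph.Adj p q := by
    have irr := fun x => G.irrefl (v := x)
    rintro ⟨i, j⟩ ⟨k, l⟩
    fin_cases i <;> fin_cases j <;> fin_cases k <;> fin_cases l <;>
      simp [f, octahedronGraph] <;> first | assumption | (rw [G.adj_comm]; assumption)
  have hinj : Function.Injective f := by
    intro p q hpq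
    have h1 : ¬ octahedronGraph.Adj p q := by
      rw [← hadj, hpq]; exact G.irrefl
    obtain ⟨i, j⟩ := p
    obtain ⟨k, l⟩ := q
    have hik : i = k := by simpa [octahedronGraph] using h1
    subst hik
    have := wv.symm
    have := ac.symm
    have := bd.symm
    fin_cases i <;> fin_cases j <;> fin_cases l <;> simp_all [f]
  have hsurj : Function.Surjective f := by
    intro x
    rcases all x with h | h | h | h | h | h
    · exact ⟨⟨0, 0⟩, h.symm⟩
    · exact ⟨⟨0, 1⟩, h.symm⟩
    · exact ⟨⟨1, 0⟩, h.symm⟩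
    · exact ⟨⟨2, 0⟩, h.symm⟩
    · exact ⟨⟨1, 1⟩, h.symm⟩
    · exact ⟨⟨2, 1⟩, h.symm⟩
  exact ⟨(RelIso.mk (Equiv.ofBijective f ⟨hinj, hsurj⟩) (fun {p q} => hadj p q) :
    octahedronGraph ≃g G).symm⟩
end

section
/- If a connected simple graph G is locally the complete graph K4 (for every vertex v, the subgraph induced on the neighborhood of v is isomorphic to K4), then G is isomorphic to the complete graph K5. -/
open SimpleGraph

/-- A connected graph that is locally the complete graph `K4` is isomorphic to
the complete graph `K5`. -/
theorem locally_K4_iso_K5 {V : Type*} (G : SimpleGraph V)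
    (hconn : G.Connected)
    (hloc : ∀ v : V,
      Nonempty ((G.induce (G.neighborSet v)) ≃g (⊤ : SimpleGraph (Fin 4)))) :
    Nonempty (G ≃g (⊤ : SimpleGraph (Fin 5))) := by
  classical
  have tr : ∀ u v w : V, G.Adj v u → G.Adj v w → u ≠ w → G.Adj u w := by
    intro u v w hu hw hne
    obtain ⟨e⟩ := hloc v
    have h : (⊤ : SimpleGraph (Fin 4)).Adj (e ⟨u, hu⟩) (e ⟨w, hw⟩) := by
      rw [top_adj]
      intro h
      exact hne (congrArg Subtype.val (e.injective h))
    exact e.map_adj_iff.mp h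
  have walk : ∀ (u w : V), G.Walk u w → u ≠ w → G.Adj u w := by
    intro u w p
    induction p with
    | nil => intro h; exact absurd rfl h
    | @cons a b c hab p ih =>
      intro hac
      by_cases hbc : b = c
      · exact hbc ▸ hab
      · exact tr a b c hab.symm (ih hbc) hac
  have all : ∀ u w : V, u ≠ w → G.Adj u w := fun u w h =>
    (hconn.preconnected u w).elim fun p => walk u w p h
  obtain ⟨v⟩ := hconn.nonempty
  obtain ⟨e⟩ := hloc v
  have hs : G.neighborSet v = {x | x ≠ v} := by
    ext x
    exact ⟨fun h => (G.ne_of_adj h).symm, fun h => all v x (Ne.symm h)⟩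
  have e1 : Option {x : V // x ≠ v} ≃ V := Equiv.optionSubtypeNe v
  have e2 : {x : V // x ≠ v} ≃ Fin 4 := (Equiv.setCongr hs).symm.trans e.toEquiv
  have e3 : V ≃ Fin 5 := e1.symm.trans ((Equiv.optionCongr e2).trans (finSuccEquiv 4).symm)
  refine ⟨⟨e3, ?_⟩⟩
  intro a b
  rw [top_adj]
  exact ⟨fun h => all a b fun hab => h (congrArg e3 hab),
    fun h hab => G.ne_of_adj h (e3.injective hab)⟩
end

section
/- If a connected simple graph G is locally the complete graph K3 (for every vertex v, the subgraph induced on the neighborhood of v is isomorphic to K3), then G is isomorphic to the complete graph K4. -/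
open SimpleGraph

/-- A connected graph that is locally the complete graph `K3` is isomorphic to
the complete graph `K4`. -/
theorem locally_K3_iso_K4 {V : Type*} (G : SimpleGraph V)
    (hconn : G.Connected)
    (hloc : ∀ v : V,
      Nonempty ((G.induce (G.neighborSet v)) ≃g (⊤ : SimpleGraph (Fin 3)))) :
    Nonempty (G ≃g (⊤ : SimpleGraph (Fin 4))) := by
  classical
  have htrans : ∀ u v w : V, G.Adj u v → G.Adj v w → u ≠ w → G.Adj u w := by
    intro u v w huv hvw hne
    obtain ⟨e⟩ := hloc v
    have h : (G.induce (G.neighborSet v)).Adj ⟨u, huv.symm⟩ ⟨w, hvw⟩ := by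
      rw [← e.map_adj_iff, top_adj]
      intro h
      exact hne (congrArg Subtype.val (e.injective h))
    exact h
  have hwalk : ∀ u v : V, G.Walk u v → u ≠ v → G.Adj u v := by
    intro u v p
    induction p with
    | nil => intro h; exact absurd rfl h
    | @cons a b c hab _ ih =>
      intro hne
      by_cases hbc : b = c
      · exact hbc ▸ hab
      · exact htrans a b c hab (ih hbc) hne
  have hadj : ∀ u v : V, G.Adj u v ↔ u ≠ v := fun u v =>
    ⟨fun h => h.ne, fun h => (hconn.preconnected u v).elim fun p => hwalk u v p h⟩
  obtain ⟨v⟩ := hconn.nonempty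
  obtain ⟨e⟩ := hloc v
  have e1 : {x : V // x ≠ v} ≃ Fin 3 :=
    (Equiv.subtypeEquivRight fun x => by
      rw [mem_neighborSet, hadj]; exact ne_comm).trans e.toEquiv
  have e2 : V ≃ Fin 4 :=
    (Equiv.optionSubtypeNe v).symm.trans ((Equiv.optionCongr e1).trans (finSuccEquiv 3).symm)
  exact ⟨⟨e2, by intro a b; rw [top_adj, hadj]; exact e2.injective.ne_iff⟩⟩
end

section
/- Let G be a connected simple graph that is locally the Rook graph K3 □ K2, let x0 be a vertex of G, and suppose the neighborhood of x0 is {a, b, c, a', b', c'}, where {a, b, c} and {a', b', c'} induce triangles and the remaining edges of the induced neighborhood are exactly aa', bb', cc'. Then every vertex of G at distance 2 from x0 has exactly four neighbors in the neighborhood of x0, and for each such vertex w and each x ∈ {a, b, c}, w is adjacent to x if and only if w is adjacent to x'. -/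
open SimpleGraph

set_option synthInstance.maxHeartbeats 400000 in
set_option synthInstance.maxSize 4000 in
set_option maxRecDepth 100000 in
set_option maxHeartbeats 1000000 in
/-- Finite check in the rook graph. -/
theorem rook_finite : ∀ s t : Fin 3 × Fin 2, rookGraph.Adj s t → ∀ u, rookGraph.Adj s u →
    rookGraph.Adj t u → ∀ z, rookGraph.Adj s z → ¬ rookGraph.Adj t z → ¬ rookGraph.Adj u z →
    ∀ w, w ≠ s → ¬ rookGraph.Adj s w →
    rookGraph.Adj w z ∧ (rookGraph.Adj w t ↔ ¬ rookGraph.Adj w u) := by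
  simp only [rookGraph, boxProd_adj, top_adj]
  decide

/-- The same fact in the neighbourhood of a vertex `v`. -/
theorem rook_local {V : Type*} (G : SimpleGraph V)
    (hloc : ∀ v : V, Nonempty ((G.induce (G.neighborSet v)) ≃g rookGraph))
    (v s t u z w : V) (hs : G.Adj v s) (ht : G.Adj v t) (hu : G.Adj v u) (hz : G.Adj v z)
    (hw : G.Adj w v) (hst : G.Adj s t) (hsu : G.Adj s u) (htu : G.Adj t u) (hsz : G.Adj s z)
    (htz : ¬ G.Adj t z) (huz : ¬ G.Adj u z) (hne : w ≠ s) (hsw : ¬ G.Adj s w) :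
    G.Adj w z ∧ (G.Adj w t ↔ ¬ G.Adj w u) := by
  obtain ⟨e⟩ := hloc v
  have key : ∀ p q : G.neighborSet v, rookGraph.Adj (e p) (e q) ↔ G.Adj p q := by
    intro p q
    rw [e.map_adj_iff]
    rfl
  have h := rook_finite (e ⟨s, hs⟩) (e ⟨t, ht⟩)
  have h' := fun a1 a2 a3 => h a1 (e ⟨u, hu⟩) a2 a3 (e ⟨z, hz⟩)
  have h'' := fun a1 a2 a3 a4 a5 a6 => h' a1 a2 a3 a4 a5 a6 (e ⟨w, hw.symm⟩)
  simp only [key] at h''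
  refine h'' hst hsu htu hsz htz huz ?_ hsw
  intro h
  exact hne (congrArg Subtype.val (e.injective h))

/-- In a connected locally `K3 □ K2` graph, if the neighbourhood of `x0` is
`{a, b, c, a', b', c'}` where `{a,b,c}` and `{a',b',c'}` induce triangles and
the remaining edges are exactly `aa'`, `bb'`, `cc'`, then every vertex at
distance `2` from `x0` has exactly four neighbours in the neighbourhood of
`x0`, and is adjacent to `x ∈ {a,b,c}` iff it is adjacent to `x'`. -/
theorem locally_rook_second_neighbourhood_structure {V : Type*} (G : SimpleGraph V)
    (hconn : G.Connected)
    (hloc : ∀ v : V, Nonempty ((G.induce (G.neighborSet v)) ≃g rookGraph))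
    (x0 a b c a' b' c' : V)
    (hnodup : List.Nodup [a, b, c, a', b', c'])
    (hnbhd : G.neighborSet x0 = {a, b, c, a', b', c'})
    (hab : G.Adj a b) (hac : G.Adj a c) (hbc : G.Adj b c)
    (hab' : G.Adj a' b') (hac' : G.Adj a' c') (hbc' : G.Adj b' c')
    (haa' : G.Adj a a') (hbb' : G.Adj b b') (hcc' : G.Adj c c')
    (hnab' : ¬ G.Adj a b') (hnac' : ¬ G.Adj a c') (hnba' : ¬ G.Adj b a')
    (hnbc' : ¬ G.Adj b c') (hnca' : ¬ G.Adj c a') (hncb' : ¬ G.Adj c b') :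
    ∀ w : V, G.dist x0 w = 2 →
      (G.neighborSet x0 ∩ G.neighborSet w).ncard = 4 ∧
      (G.Adj w a ↔ G.Adj w a') ∧ (G.Adj w b ↔ G.Adj w b') ∧
      (G.Adj w c ↔ G.Adj w c') := by
  intro w hw
  have hx : ∀ y, G.Adj x0 y ↔ y = a ∨ y = b ∨ y = c ∨ y = a' ∨ y = b' ∨ y = c' := by
    intro y
    rw [← mem_neighborSet, hnbhd]
    simp
  have xa : G.Adj x0 a := by simp [hx]
  have xb : G.Adj x0 b := by simp [hx]
  have xc : G.Adj x0 c := by simp [hx]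
  have xa' : G.Adj x0 a' := by simp [hx]
  have xb' : G.Adj x0 b' := by simp [hx]
  have xc' : G.Adj x0 c' := by simp [hx]
  have hne : w ≠ x0 := by
    rintro rfl
    simp at hw
  have hnadj : ¬ G.Adj x0 w := by
    intro h
    rw [dist_eq_one_iff_adj.mpr h] at hw
    omega
  have L := rook_local G hloc
  have Ha : G.Adj w a → G.Adj w a' ∧ (G.Adj w b ↔ ¬ G.Adj w c) := fun h =>
    L a x0 b c a' w xa.symm hab hac haa' h xb xc hbc xa' hnba' hnca' hne hnadj
  have Hb : G.Adj w b → G.Adj w b' ∧ (G.Adj w a ↔ ¬ G.Adj w c) := fun h =>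
    L b x0 a c b' w xb.symm hab.symm hbc hbb' h xa xc hac xb' hnab' hncb' hne hnadj
  have Hc : G.Adj w c → G.Adj w c' ∧ (G.Adj w a ↔ ¬ G.Adj w b) := fun h =>
    L c x0 a b c' w xc.symm hac.symm hbc.symm hcc' h xa xb hab xc' hnac' hnbc' hne hnadj
  have Ha' : G.Adj w a' → G.Adj w a ∧ (G.Adj w b' ↔ ¬ G.Adj w c') := fun h =>
    L a' x0 b' c' a w xa'.symm hab' hac' haa'.symm h xb' xc' hbc' xa
      (fun h => hnab' h.symm) (fun h => hnac' h.symm) hne hnadj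
  have Hb' : G.Adj w b' → G.Adj w b ∧ (G.Adj w a' ↔ ¬ G.Adj w c') := fun h =>
    L b' x0 a' c' b w xb'.symm hab'.symm hbc' hbb'.symm h xa' xc' hac' xb
      (fun h => hnba' h.symm) (fun h => hnbc' h.symm) hne hnadj
  have Hc' : G.Adj w c' → G.Adj w c ∧ (G.Adj w a' ↔ ¬ G.Adj w b') := fun h =>
    L c' x0 a' b' c w xc'.symm hac'.symm hbc'.symm hcc'.symm h xa' xb' hab' xc
      (fun h => hnca' h.symm) (fun h => hncb' h.symm) hne hnadj
  have ea : G.Adj w a ↔ G.Adj w a' := ⟨fun h => (Ha h).1, fun h => (Ha' h).1⟩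
  have eb : G.Adj w b ↔ G.Adj w b' := ⟨fun h => (Hb h).1, fun h => (Hb' h).1⟩
  have ec : G.Adj w c ↔ G.Adj w c' := ⟨fun h => (Hc h).1, fun h => (Hc' h).1⟩
  refine ⟨?_, ea, eb, ec⟩
  -- some neighbour of `x0` is adjacent to `w`
  have hex : ∃ y, G.Adj x0 y ∧ G.Adj w y := by
    obtain ⟨p, hp⟩ := hconn.exists_walk_length_eq_dist x0 w
    rw [hw] at hp
    refine ⟨p.getVert 1, ?_, ?_⟩
    · simpa using p.adj_getVert_succ (i := 0) (by omega)
    · have h := p.adj_getVert_succ (i := 1) (by omega)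
      have h2 : p.getVert (1 + 1) = w := by
        have := p.getVert_length
        rwa [hp] at this
      rw [h2] at h
      exact h.symm
  have hsome : G.Adj w a ∨ G.Adj w b ∨ G.Adj w c := by
    obtain ⟨y, hy, hwy⟩ := hex
    rw [hx] at hy
    rcases hy with h | h | h | h | h | h <;> rw [h] at hwy
    · exact Or.inl hwy
    · exact Or.inr (Or.inl hwy)
    · exact Or.inr (Or.inr hwy)
    · exact Or.inl (ea.mpr hwy)
    · exact Or.inr (Or.inl (eb.mpr hwy))
    · exact Or.inr (Or.inr (ec.mpr hwy))
  have four : ∀ p q r s : V, List.Nodup [p, q, r, s] →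
      (∀ y, (G.Adj x0 y ∧ G.Adj w y) ↔ y = p ∨ y = q ∨ y = r ∨ y = s) →
      (G.neighborSet x0 ∩ G.neighborSet w).ncard = 4 := by
    classical
    intro p q r s hnd h
    have : G.neighborSet x0 ∩ G.neighborSet w = (([p, q, r, s].toFinset : Finset V) : Set V) := by
      ext y
      simpa using h y
    rw [this, Set.ncard_coe_finset, List.toFinset_card_of_nodup hnd]
    rfl
  have cases3 : (G.Adj w a ∧ G.Adj w b ∧ ¬ G.Adj w c) ∨ (G.Adj w a ∧ ¬ G.Adj w b ∧ G.Adj w c) ∨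
      (¬ G.Adj w a ∧ G.Adj w b ∧ G.Adj w c) := by
    have A := fun h => (Ha h).2
    have B := fun h => (Hb h).2
    have C := fun h => (Hc h).2
    clear * - A B C hsome
    grind
  rcases cases3 with ⟨h1, h2, h3⟩ | ⟨h1, h2, h3⟩ | ⟨h1, h2, h3⟩
  · refine four a b a' b' (by simp at hnodup ⊢; grind) fun y => ?_
    rw [hx]
    grind
  · refine four a c a' c' (by simp at hnodup ⊢; grind) fun y => ?_
    rw [hx]
    grind
  · refine four b c b' c' (by simp at hnodup ⊢; grind) fun y => ?_
    rw [hx]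
    grind
end

section
/- Let G be a connected simple graph that is locally the Rook graph K3 □ K2, and let x0 be a vertex of G. Then the set of vertices at distance 2 from x0 has exactly three elements, these three vertices are pairwise adjacent (they form a triangle), and there are no vertices at distance greater than 2 from x0. -/
open SimpleGraph

theorem rook_adj (p q : Fin 3 × Fin 2) :
    rookGraph.Adj p q ↔ (p.1 ≠ q.1 ∧ p.2 = q.2) ∨ (p.2 ≠ q.2 ∧ p.1 = q.1) := by
  simp [rookGraph, SimpleGraph.boxProd_adj]

set_option synthInstance.maxHeartbeats 1000000 in
set_option synthInstance.maxSize 100000 in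
set_option maxHeartbeats 2000000 in
set_option maxRecDepth 100000 in
/-- Completing a triangle plus one mate to the whole prism, in the prism itself. -/
theorem rook_ext : ∀ x y z w : Fin 3 × Fin 2,
    rookGraph.Adj x y → rookGraph.Adj x z → rookGraph.Adj y z → rookGraph.Adj x w →
    w ≠ y → w ≠ z → ¬ rookGraph.Adj w y → ¬ rookGraph.Adj w z →
    ∃ p q : Fin 3 × Fin 2, (∀ u, u = x ∨ u = y ∨ u = z ∨ u = w ∨ u = p ∨ u = q) ∧
      p ≠ y ∧ p ≠ z ∧ p ≠ x ∧ p ≠ w ∧ q ≠ y ∧ q ≠ z ∧ q ≠ x ∧ q ≠ w ∧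
      rookGraph.Adj p w ∧ rookGraph.Adj q w ∧ rookGraph.Adj p q ∧
      rookGraph.Adj p y ∧ rookGraph.Adj q z ∧
      ¬ rookGraph.Adj p x ∧ ¬ rookGraph.Adj q x ∧
      ¬ rookGraph.Adj p z ∧ ¬ rookGraph.Adj q y := by
  intro x y z w h1 h2 h3 h4 h5 h6 h7 h8
  refine ⟨(y.1, w.2), (z.1, w.2), ?_⟩
  simp only [rook_adj] at *
  revert x y z w
  decide

theorem local_ext {V : Type*} (G : SimpleGraph V)
    (hloc : ∀ v : V, Nonempty ((G.induce (G.neighborSet v)) ≃g rookGraph))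
    (v x y z w : V) (hx : G.Adj v x) (hy : G.Adj v y) (hz : G.Adj v z) (hw : G.Adj v w)
    (h1 : G.Adj x y) (h2 : G.Adj x z) (h3 : G.Adj y z) (h4 : G.Adj x w)
    (h5 : w ≠ y) (h6 : w ≠ z) (h7 : ¬ G.Adj w y) (h8 : ¬ G.Adj w z) :
    ∃ p q : V, G.Adj v p ∧ G.Adj v q ∧
      (∀ u, G.Adj v u → u = x ∨ u = y ∨ u = z ∨ u = w ∨ u = p ∨ u = q) ∧
      p ≠ y ∧ p ≠ z ∧ p ≠ x ∧ p ≠ w ∧ q ≠ y ∧ q ≠ z ∧ q ≠ x ∧ q ≠ w ∧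
      G.Adj p w ∧ G.Adj q w ∧ G.Adj p q ∧ G.Adj p y ∧ G.Adj q z ∧
      ¬ G.Adj p x ∧ ¬ G.Adj q x ∧ ¬ G.Adj p z ∧ ¬ G.Adj q y := by
  obtain ⟨e⟩ := hloc v
  have hadj : ∀ a b : G.neighborSet v, rookGraph.Adj (e a) (e b) ↔ G.Adj a b := by
    intro a b
    rw [e.map_adj_iff]
    rfl
  have hne : ∀ a b : G.neighborSet v, e a = e b ↔ (a : V) = b := by
    intro a b
    rw [e.injective.eq_iff, Subtype.ext_iff]
  obtain ⟨p, q, hu, H⟩ := rook_ext (e ⟨x, hx⟩) (e ⟨y, hy⟩) (e ⟨z, hz⟩) (e ⟨w, hw⟩)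
    ((hadj _ _).2 h1) ((hadj _ _).2 h2) ((hadj _ _).2 h3) ((hadj _ _).2 h4)
    (fun h => h5 ((hne _ _).1 h)) (fun h => h6 ((hne _ _).1 h))
    (fun h => h7 ((hadj _ _).1 h)) (fun h => h8 ((hadj _ _).1 h))
  obtain ⟨p, rfl⟩ := e.surjective p
  obtain ⟨q, rfl⟩ := e.surjective q
  simp only [hadj, hne, ne_eq] at H
  refine ⟨p, q, p.2, q.2, ?_, H⟩
  intro u huv
  have := hu (e ⟨u, huv⟩)
  simpa only [hne] using this

theorem local_start {V : Type*} (G : SimpleGraph V)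
    (hloc : ∀ v : V, Nonempty ((G.induce (G.neighborSet v)) ≃g rookGraph)) (v : V) :
    ∃ a b : Fin 3 → V, (∀ i, G.Adj v (a i)) ∧ (∀ i, G.Adj v (b i)) ∧
      (∀ u, G.Adj v u → (∃ i, u = a i) ∨ ∃ i, u = b i) ∧
      (∀ i j, i ≠ j → G.Adj (a i) (a j)) ∧ (∀ i j, i ≠ j → G.Adj (b i) (b j)) ∧
      (∀ i j, G.Adj (a i) (b j) ↔ i = j) ∧ (∀ i j, a i ≠ b j) := by
  obtain ⟨e⟩ := hloc v
  have hadj : ∀ a b, G.Adj (e.symm a : V) (e.symm b) ↔ rookGraph.Adj a b := by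
    intro a b
    rw [← e.symm.map_adj_iff]
    rfl
  refine ⟨fun i => e.symm (i, 0), fun i => e.symm (i, 1), fun i => (e.symm (i, 0)).2,
    fun i => (e.symm (i, 1)).2, ?_, ?_, ?_, ?_, ?_⟩
  · intro u hu
    have h : (e.symm (e ⟨u, hu⟩) : V) = u := by simp
    rcases hh : e ⟨u, hu⟩ with ⟨i, j⟩
    rw [hh] at h
    fin_cases j
    · exact Or.inl ⟨i, h.symm⟩
    · exact Or.inr ⟨i, h.symm⟩
  · intro i j h
    simp [hadj, rook_adj, h]
  · intro i j h
    simp [hadj, rook_adj, h]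
  · intro i j
    simp [hadj, rook_adj]
  · intro i j h
    have := e.symm.injective (Subtype.ext h)
    simp at this

set_option maxHeartbeats 1000000 in
/-- The global structure: ten vertices. -/
theorem structure_ten {V : Type*} (G : SimpleGraph V)
    (hloc : ∀ v : V, Nonempty ((G.induce (G.neighborSet v)) ≃g rookGraph)) (x : V) :
    ∃ c d e : V, G.Adj c d ∧ G.Adj c e ∧ G.Adj d e ∧
      (∀ u, u = c ∨ u = d ∨ u = e → u ≠ x ∧ ¬ G.Adj x u ∧ ∃ m, G.Adj x m ∧ G.Adj m u) ∧
      (∀ m u, G.Adj x m → G.Adj m u → u = x ∨ G.Adj x u ∨ u = c ∨ u = d ∨ u = e) ∧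
      (∀ m u, m = c ∨ m = d ∨ m = e → G.Adj m u → G.Adj x u ∨ u = c ∨ u = d ∨ u = e) := by
  obtain ⟨a, b, ha, hb, hN, haa, hbb, hab, hne⟩ := local_start G hloc x
  have key : ∀ i j k : Fin 3, i ≠ j → i ≠ k → j ≠ k → ∃ p q : V,
      G.Adj (a i) p ∧ G.Adj (a i) q ∧
      (∀ u, G.Adj (a i) u → u = x ∨ u = a j ∨ u = a k ∨ u = b i ∨ u = p ∨ u = q) ∧
      p ≠ a j ∧ p ≠ a k ∧ p ≠ x ∧ p ≠ b i ∧ q ≠ a j ∧ q ≠ a k ∧ q ≠ x ∧ q ≠ b i ∧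
      G.Adj p (b i) ∧ G.Adj q (b i) ∧ G.Adj p q ∧ G.Adj p (a j) ∧ G.Adj q (a k) ∧
      ¬ G.Adj p x ∧ ¬ G.Adj q x ∧ ¬ G.Adj p (a k) ∧ ¬ G.Adj q (a j) := by
    intro i j k hij hik hjk
    apply local_ext G hloc (a i) x (a j) (a k) (b i) (ha i).symm (haa _ _ hij) (haa _ _ hik)
      ((hab _ _).2 rfl) (ha _) (ha _) (haa _ _ hjk) (hb _) (hne _ _).symm (hne _ _).symm
    · rw [G.adj_comm, hab]; exact hij.symm
    · rw [G.adj_comm, hab]; exact hik.symm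
  obtain ⟨c, d, hc, hd, hN0, p1, p2, p3, p4, p5, p6, p7, p8, p9, p10, p11, p12, p13, p14, p15,
    p16, p17⟩ := key 0 1 2 (by decide) (by decide) (by decide)
  obtain ⟨c', e, hc', he, hN1, q1, q2, q3, q4, q5, q6, q7, q8, q9, q10, q11, q12, q13, q14, q15,
    q16, q17⟩ := key 1 0 2 (by decide) (by decide) (by decide)
  obtain ⟨d', e', hd', he', hN2, r1, r2, r3, r4, r5, r6, r7, r8, r9, r10, r11, r12, r13, r14, r15,
    r16, r17⟩ := key 2 0 1 (by decide) (by decide) (by decide)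
  have nab : ∀ i j, i ≠ j → ¬ G.Adj (a i) (b j) := fun i j h => by rw [hab]; exact h
  have n01 := nab 0 1 (by decide)
  have n02 := nab 0 2 (by decide)
  have n10 := nab 1 0 (by decide)
  have n12 := nab 1 2 (by decide)
  have n20 := nab 2 0 (by decide)
  have n21 := nab 2 1 (by decide)
  have ecc : c' = c := by
    rcases hN1 c p12.symm with h | h | h | h | h | h
    · exact absurd h p3
    · exact absurd (h ▸ hc) (G.irrefl)
    · exact absurd h p2
    · exact absurd (h ▸ hc) n01
    · exact h.symm
    · exact absurd (h ▸ hc.symm) q17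
  subst ecc
  have edd : d' = d := by
    rcases hN2 d p13.symm with h | h | h | h | h | h
    · exact absurd h p7
    · exact absurd (h ▸ hd) (G.irrefl)
    · exact absurd h p5
    · exact absurd (h ▸ hd) n02
    · exact h.symm
    · exact absurd (h ▸ hd.symm) r17
  subst edd
  have eee : e' = e := by
    rcases hN2 e q13.symm with h | h | h | h | h | h
    · exact absurd h q7
    · exact absurd h q5
    · exact absurd (h ▸ he) (G.irrefl)
    · exact absurd (h ▸ he) n12
    · exact absurd (h ▸ he.symm) r16
    · exact h.symm
  subst eee
  have keyb : ∀ i j k : Fin 3, i ≠ j → i ≠ k → j ≠ k → ∀ s t, s ≠ t → G.Adj s (b i) →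
      G.Adj t (b i) → ¬ G.Adj x s → ¬ G.Adj x t → s ≠ x → t ≠ x →
      ∀ u, G.Adj (b i) u → u = x ∨ G.Adj x u ∨ u = s ∨ u = t := by
    intro i j k hij hik hjk s t hst hs ht hxs hxt hsx htx u hu
    obtain ⟨p, q, -, -, H, -⟩ := local_ext G hloc (b i) x (b j) (b k) (a i) (hb i).symm
      (hbb _ _ hij) (hbb _ _ hik) ((hab _ _).2 rfl).symm (hb _) (hb _) (hbb _ _ hjk) (ha _)
      (hne _ _) (hne _ _) (nab _ _ hij) (nab _ _ hik)
    have h1 := H s hs.symm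
    have h2 := H t ht.symm
    have h3 := H u hu
    have := ha i
    have := hb j
    have := hb k
    grind
  have keyc : ∀ (v x y z w s t : V), (G.Adj v x) → (G.Adj v y) → (G.Adj v z) → (G.Adj v w) →
    (G.Adj x y) → (G.Adj x z) → (G.Adj y z) → (G.Adj x w) →
    (w ≠ y) → (w ≠ z) → (¬ G.Adj w y) → (¬ G.Adj w z) → G.Adj v s → G.Adj v t → s ≠ t →
    s ≠ x → s ≠ y → s ≠ z → s ≠ w → t ≠ x → t ≠ y → t ≠ z → t ≠ w → 
    ∀ u, G.Adj v u → u = x ∨ u = y ∨ u = z ∨ u = w ∨ u = s ∨ u = t := by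
    intro v x y z w s t h1 h2 h3 h4 h5 h6 h7 h8 h9 h10 h11 h12 hs ht _ _ _ _ _ _ _ _ _ u hu
    obtain ⟨p, q, -, -, H, -⟩ := local_ext G hloc v x y z w h1 h2 h3 h4 h5 h6 h7 h8 h9 h10 h11 h12
    have := H s hs
    have := H t ht
    have := H u hu
    grind
  have hbs : ∀ i, b i ≠ c' ∧ b i ≠ d' ∧ b i ≠ e' := by
    intro i
    have := hb i
    refine ⟨?_, ?_, ?_⟩ <;> rintro h <;> rw [h] at this
    exacts [p14 this.symm, p15 this.symm, r15 this.symm]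
  have has : ∀ i, a i ≠ c' ∧ a i ≠ d' ∧ a i ≠ e' := by
    intro i
    have := ha i
    refine ⟨?_, ?_, ?_⟩ <;> rintro h <;> rw [h] at this
    exacts [p14 this.symm, p15 this.symm, r15 this.symm]
  have ab0 := (hab 0 0).2 rfl
  have ab1 := (hab 1 1).2 rfl
  have ab2 := (hab 2 2).2 rfl
  have hca := haa 0 1 (by decide)
  have hda := haa 0 2 (by decide)
  have hea := haa 1 2 (by decide)
  have b01 := (hbb 0 1 (by decide)).ne
  have b02 := (hbb 0 2 (by decide)).ne
  have b12 := (hbb 1 2 (by decide)).ne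
  have Nc := keyc c' (a 0) (b 0) d' (a 1) (b 1) e' hc.symm p9 p11 p12 ab0 hd p10.symm hca
    (hne _ _) (has 1).2.1 n10 (fun h => p17 h.symm) q9 q11 (hbs 1).2.2
    (hne _ _).symm b01.symm (hbs 1).2.1 (hne _ _).symm (has 0).2.2.symm (hbs 0).2.2.symm r11.ne.symm
    (has 1).2.2.symm
  have Nd := keyc d' (a 0) (b 0) c' (a 2) (b 2) e' hd.symm p10 p11.symm p13 ab0 hc p9.symm hda
    (hne _ _) (has 2).1 n20 (fun h => p16 h.symm) r9 r11 (hbs 2).2.2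
    (hne _ _).symm b02.symm (hbs 2).1 (hne _ _).symm (has 0).2.2.symm (hbs 0).2.2.symm q11.ne.symm
    (has 2).2.2.symm
  have Ne := keyc e' (a 1) (b 1) c' (a 2) (b 2) d' he.symm q10 q11.symm q13 ab1 hc' q9.symm hea
    (hne _ _) (has 2).1 n21 (fun h => p16 h.symm) r10 r11.symm (hbs 2).2.1
    (hne _ _).symm b12.symm (hbs 2).1 (hne _ _).symm (has 1).2.1.symm (hbs 1).2.1.symm p11.ne.symm
    (has 2).2.1.symm
  have xc : ¬ G.Adj x c' := fun h => p14 h.symm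
  have xd : ¬ G.Adj x d' := fun h => p15 h.symm
  have xe : ¬ G.Adj x e' := fun h => r15 h.symm
  refine ⟨c', d', e', p11, q11, r11, ?_, ?_, ?_⟩
  · rintro u (rfl | rfl | rfl)
    · exact ⟨p3, xc, a 0, ha 0, hc⟩
    · exact ⟨p7, xd, a 0, ha 0, hd⟩
    · exact ⟨q7, xe, a 1, ha 1, he⟩
  · intro m u hm hu
    rcases hN m hm with ⟨i, rfl⟩ | ⟨i, rfl⟩
    · have hi : i = 0 ∨ i = 1 ∨ i = 2 := by omega
      rcases hi with rfl | rfl | rfl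
      · rcases hN0 u hu with rfl | rfl | rfl | rfl | rfl | rfl <;> simp [ha, hb]
      · rcases hN1 u hu with rfl | rfl | rfl | rfl | rfl | rfl <;> simp [ha, hb]
      · rcases hN2 u hu with rfl | rfl | rfl | rfl | rfl | rfl <;> simp [ha, hb]
    · have hi : i = 0 ∨ i = 1 ∨ i = 2 := by omega
      rcases hi with rfl | rfl | rfl
      · have := keyb 0 1 2 (by decide) (by decide) (by decide) c' d' p11.ne p9 p10 xc xd p3 p7 u hu
        tauto
      · have := keyb 1 0 2 (by decide) (by decide) (by decide) c' e' q11.ne q9 q10 xc xe p3 q7 u hu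
        tauto
      · have := keyb 2 0 1 (by decide) (by decide) (by decide) d' e' r11.ne r9 r10 xd xe p7 q7 u hu
        tauto
  · rintro m u hm hu
    rcases hm with rfl | rfl | rfl
    · rcases Nc u hu with rfl | rfl | rfl | rfl | rfl | rfl <;> simp [ha, hb]
    · rcases Nd u hu with rfl | rfl | rfl | rfl | rfl | rfl <;> simp [ha, hb]
    · rcases Ne u hu with rfl | rfl | rfl | rfl | rfl | rfl <;> simp [ha, hb]

/-- In a connected graph that is locally the Rook graph `K3 □ K2`, for any
vertex `x0` there are exactly three vertices at distance 2 from `x0`, they are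
pairwise adjacent, and no vertex is at distance greater than 2 from `x0`. -/
theorem locally_rook_second_neighbourhood {V : Type*} (G : SimpleGraph V)
    (hconn : G.Connected)
    (hloc : ∀ v : V, Nonempty ((G.induce (G.neighborSet v)) ≃g rookGraph))
    (x0 : V) :
    {w : V | G.dist x0 w = 2}.ncard = 3 ∧
      (∀ w ∈ {w : V | G.dist x0 w = 2}, ∀ w' ∈ {w : V | G.dist x0 w = 2},
        w ≠ w' → G.Adj w w') ∧
      ∀ w : V, G.dist x0 w ≤ 2 := by
  obtain ⟨c, d, e, hcd, hce, hde, h2, hN, hM⟩ := structure_ten G hloc x0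
  have hall : ∀ u, u = x0 ∨ G.Adj x0 u ∨ u = c ∨ u = d ∨ u = e := by
    intro u
    obtain ⟨p⟩ := hconn.preconnected u x0
    induction p with
    | nil => exact Or.inl rfl
    | @cons u v w h p ih =>
      rcases ih h2 hN hM with h' | h' | h'
      · subst h'; exact Or.inr (Or.inl h.symm)
      · exact hN v u h' h.symm
      · exact Or.inr (hM v u h' h.symm)
  have hd2 : ∀ u, u = c ∨ u = d ∨ u = e → G.dist x0 u = 2 := by
    intro u hu
    obtain ⟨hne, hna, m, hm, hmu⟩ := h2 u hu
    have hle : G.dist x0 u ≤ 2 := G.dist_le (.cons hm (.cons hmu .nil))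
    have h0 : G.dist x0 u ≠ 0 := fun h => hne (hconn.dist_eq_zero_iff.1 h).symm
    have h1 : G.dist x0 u ≠ 1 := fun h => hna (G.dist_eq_one_iff_adj.1 h)
    omega
  have hset : {w : V | G.dist x0 w = 2} = {c, d, e} := by
    ext u
    simp only [Set.mem_ofPred_eq, Set.mem_insert_iff, Set.mem_singleton_iff]
    refine ⟨fun h => ?_, hd2 u⟩
    rcases hall u with h' | h' | h'
    · subst h'; simp at h
    · rw [G.dist_eq_one_iff_adj.2 h'] at h; omega
    · exact h'
  refine ⟨?_, ?_, ?_⟩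
  · rw [hset]
    exact Set.ncard_eq_three.2 ⟨c, d, e, hcd.ne, hce.ne, hde.ne, rfl⟩
  · rw [hset]
    have := hcd.symm
    have := hce.symm
    have := hde.symm
    simp only [Set.mem_insert_iff, Set.mem_singleton_iff]
    rintro w (rfl | rfl | rfl) w' (rfl | rfl | rfl) hne <;> first | assumption | exact absurd rfl hne
  · intro w
    rcases hall w with h' | h' | h'
    · subst h'; simp
    · rw [G.dist_eq_one_iff_adj.2 h']; omega
    · exact (hd2 w h').le
end
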